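/- Let G be a finite simple graph with at least one edge, with no K_7-minor, and such that every edge incident to a vertex of degree at most 9 belongs to at least 5 triangles. Then for every vertex u of degree at most 9 and every connected component C of G \ N[u], there exists a vertex of C whose degree in G is at most 9. -/

import Mathlib

open SimpleGraph

/-- `H` is a minor of `G`: there is a family of nonempty, pairwise disjoint,
connected branch sets in `G`, one for each vertex of `H`, with an edge of `G`
between the branch sets corresponding to each edge of `H`. -/
def SimpleGraph.MinorOf {W V : Type} (H : SimpleGraph W) (G : SimpleGraph V) : Prop :=
  ∃ f : W → Set V,
    (∀ w, (f w).Nonempty) ∧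
    (∀ w, (G.induce (f w)).Connected) ∧
    (∀ w₁ w₂, w₁ ≠ w₂ → Disjoint (f w₁) (f w₂)) ∧
    (∀ w₁ w₂, H.Adj w₁ w₂ → ∃ v₁ ∈ f w₁, ∃ v₂ ∈ f w₂, G.Adj v₁ v₂)

/-- `f x`, arranged so that the kernel evaluates `x` before unfolding `f`. -/
def force (x : ℕ) (f : ℕ → Bool) : Bool := Nat.rec (f 0) (fun m _ => f (Nat.succ m)) x

/-- Graphs on at most nine vertices are coded by `9 × 9` bit matrices. Here and in the `explore`
functions, `A` codes the complement of the graph of interest. -/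
def bitAt (A a b : ℕ) : Bool :=
  Nat.beq (Nat.land 1 (Nat.shiftRight A (Nat.add (Nat.mul 9 a) b))) 1

def rowMask (A a : ℕ) : ℕ := Nat.mod (Nat.shiftRight A (Nat.mul 9 a)) 512

/-- The number of ones among the lowest nine bits. -/
def popCount (r : ℕ) : ℕ :=
  Nat.mod (Nat.land (Nat.mul r 35185445863425) 76861433640456465) 15

def rowCount (A a : ℕ) : ℕ := popCount (rowMask A a)

/-- The code of the single edge `ab`. -/
def pairMask (a b : ℕ) : ℕ :=
  Nat.lor (Nat.shiftLeft 1 (Nat.add (Nat.mul 9 a) b)) (Nat.shiftLeft 1 (Nat.add (Nat.mul 9 b) a))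

/-- Adjacency in the graph whose complement is coded by `A`. -/
def nonAdj (A a b : ℕ) : Bool := !Nat.beq a b && !bitAt A a b

def anyB {α : Type} (p : α → Bool) : List α → Bool
  | [] => false
  | a :: l => p a || anyB p l

def allB {α : Type} (p : α → Bool) : List α → Bool
  | [] => true
  | a :: l => p a && allB p l

/-- A sufficient condition for the vertices of a list to induce a connected subgraph: each is
adjacent to a later one. -/
def bagConnected (A : ℕ) : List ℕ → Bool
  | [] => false
  | a :: l => (match l with | [] => true | _ :: _ => anyB (nonAdj A a) l && bagConnected A l)

def bagsTouch (A : ℕ) (l m : List ℕ) : Bool := anyB (fun a => anyB (nonAdj A a) m) l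

def bagsDisjoint (l m : List ℕ) : Bool := allB (fun a => allB (fun b => !Nat.beq a b) m) l

def bagsPairwise (A : ℕ) : List (List ℕ) → Bool
  | [] => true
  | l :: L => allB (fun m => bagsTouch A l m && bagsDisjoint l m) L && bagsPairwise A L

/-- `L` lists the branch sets of a model of the complete graph on six vertices. -/
def isModel (n A : ℕ) (L : List (List ℕ)) : Bool :=
  Nat.beq L.length 6 &&
    allB (fun l => bagConnected A l && allB (fun a => Nat.ble (Nat.succ a) n) l) L &&
    bagsPairwise A L

/-- Search for the branch sets with at least two vertices. The current set `bag` has vertex set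
`mask`, its common non-neighbours are `cj`, `rest` is the set of unused vertices and `ws` the set of
candidates for extending `bag`; `budget` bounds the number of vertices beyond two per set, and `S`
is the set of vertices used as singleton branch sets. -/
def growBags (n A S : ℕ) :
    ℕ → (rest ws budget mask cj : ℕ) → (bag : List ℕ) → (bags : List (List ℕ)) →
    (masks : List ℕ) → Bool
  | 0, _, _, _, _, _, _, _, _ => false
  | fuel + 1, rest, ws, budget, mask, cj, bag, bags, masks =>
    !Nat.beq ws 0 &&
    force (Nat.log2 ws) fun w =>
    force (Nat.shiftLeft 1 w) fun bw =>
    force (Nat.xor rest bw) fun rest' =>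
    force (Nat.lor mask bw) fun mask' =>
    force (Nat.land cj (rowMask A w)) fun cj' =>
    (Nat.beq (Nat.land cj' S) 0 && allB (fun m => !Nat.beq (Nat.land m cj') m) masks &&
      (match Nat.beq rest' 0 with
      | true => isModel n A ((w :: bag) :: bags)
      | false =>
        force (Nat.log2 rest') fun v =>
        force (Nat.shiftLeft 1 v) fun bv =>
        force (Nat.xor rest' bv) fun rest'' =>
        force (rowMask A v) fun cv =>
        growBags n A S fuel rest'' (Nat.sub rest'' (Nat.land rest'' cv)) budget bv cv [v]
          ((w :: bag) :: bags) (mask' :: masks))) ||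
    (!Nat.beq budget 0 &&
      force (Nat.sub budget 1) fun budget' =>
      force (Nat.sub rest' (Nat.land rest' cj')) fun ws' =>
      growBags n A S fuel rest' ws' budget' mask' cj' (w :: bag) bags masks) ||
    force (Nat.xor ws bw) fun ws' => growBags n A S fuel rest ws' budget mask cj bag bags masks

/-- Search for the singleton branch sets `S`, among the candidates `cand`. -/
def chooseSingles (n A : ℕ) : ℕ → (cand S s rest : ℕ) → (bags : List (List ℕ)) → Bool
  | 0, _, _, _, _, _ => false
  | fuel + 1, cand, S, s, rest, bags =>
    match Nat.beq cand 0 with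
    | true => Nat.ble (Nat.sub 12 n) s &&
      (match Nat.beq rest 0 with
      | true => isModel n A bags
      | false => Nat.ble s 5 &&
        force (Nat.log2 rest) fun v =>
        force (Nat.shiftLeft 1 v) fun bv =>
        force (Nat.xor rest bv) fun rest' =>
        force (rowMask A v) fun cv =>
        growBags n A S 100 rest' (Nat.sub rest' (Nat.land rest' cv))
          (Nat.sub (Nat.add n s) 12) bv cv [v] bags [])
    | false =>
      force (Nat.log2 cand) fun v =>
      force (Nat.shiftLeft 1 v) fun bv =>
      force (Nat.xor cand bv) fun cand' =>
      (force (Nat.sub cand' (Nat.land cand' (rowMask A v))) fun c =>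
       force (Nat.lor S bv) fun S' =>
       force (Nat.xor rest bv) fun rest' =>
       force (Nat.succ s) fun s' =>
       chooseSingles n A fuel c S' s' rest' ([v] :: bags)) ||
      chooseSingles n A fuel cand' S s rest bags

/-- Search for a model of the complete graph on six vertices in the complement of `A`. -/
def hasModel (n A : ℕ) : Bool :=
  force (Nat.sub (Nat.pow 2 n) 1) fun f => chooseSingles n A 12 f 0 0 f []

/-- All pairs `(a, b)` with `a < b < n`. -/
def pairList (n : ℕ) : List (ℕ × ℕ) :=
  (List.range n).flatMap fun b => (List.range b).map fun a => (a, b)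

/-- The number of pairs of `D` that contain `v`. -/
def incident (D : List (ℕ × ℕ)) (v : ℕ) : ℕ := D.countP fun p => p.1 == v || p.2 == v

/-- `D` is empty, or some vertex is in at least half of its pairs, or two vertices covered by `D`
are joined in `A` by an edge outside `F`. -/
def sublistOK (n A : ℕ) (F D : List (ℕ × ℕ)) : Bool :=
  D.isEmpty || (List.range n).any (fun v => incident D v != 0 && D.length ≤ 2 * incident D v) ||
    (pairList n).any fun p => bitAt A p.1 p.2 && incident D p.1 != 0 && incident D p.2 != 0 &&
      !F.contains p
/-- Codes of graphs whose complement may fail to have a model of the complete graph on six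
vertices, each with a list of edges whose individual removal need not create one. -/
def exceptional : List (ℕ × List (ℕ × ℕ)) :=
  [(578713104020932608, []),
   (888042578952273529350, [(0, 1), (0, 2), (1, 2)]),
   (888332775526070751750, [(5, 6), (5, 7), (6, 7)]),
   (888332775526341018114, []),
   (888042578675790512642, []),
   (1060916216674583539616262, [(0, 1), (0, 2), (1, 2)]),
   (1060619055099619822012934, [(0, 1), (0, 2), (1, 2)]),
   (985061472861876348783110, [(0, 1), (0, 2), (1, 2)]),
   (834238591975817468447238, [(0, 1), (0, 2), (1, 2)]),
   (985060966347241586700806, [(1, 4), (4, 7), (4, 8), (7, 8)]),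
   (834238085461182706364934, [(1, 4), (4, 7), (4, 8), (7, 8)]),
   (985284485056709085377030, [(2, 6), (6, 7), (6, 8), (7, 8)]),
   (834164442595686487437830, [(0, 1), (0, 2), (3, 5), (4, 6), (7, 8)]),
   (529723701863224369754630, [(1, 3), (2, 5), (4, 7), (6, 8)]),
   (984987179645837540340230, [(0, 1), (0, 2), (3, 6), (4, 5), (7, 8)]),
   (833867137184814942401030, [(2, 5), (5, 7), (5, 8), (7, 8)]),
   (529426396452352824717830, [(1, 3), (2, 6), (4, 7), (5, 8)]),
   (947208391884900084756998, [(1, 3), (3, 7), (3, 8), (7, 8)]),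
   (796385510998841204421126, [(1, 3), (3, 7), (3, 8), (7, 8)]),
   (491944770266379086737926, [(1, 4), (2, 5), (3, 7), (6, 8)]),
   (416534475998250905383430, [(1, 4), (2, 5), (3, 8), (6, 7)]),
   (491647608691415369134598, [(1, 4), (2, 6), (3, 7), (5, 8)]),
   (265414433537228307444230, [(1, 4), (2, 6), (3, 8), (5, 7)]),
   (834164442595686487701504, [(1, 2), (3, 5), (4, 6), (7, 8)]),
   (529723701863224370018304, [(1, 3), (2, 5), (4, 7), (6, 8)]),
   (984987179645837540603904, [(1, 2), (3, 6), (4, 5), (7, 8)]),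
   (529426396452352824981504, [(1, 3), (2, 6), (4, 7), (5, 8)]),
   (491944770266379087001600, [(1, 4), (2, 5), (3, 7), (6, 8)]),
   (416534475998250905647104, [(1, 4), (2, 5), (3, 8), (6, 7)]),
   (491647608691415369398272, [(1, 4), (2, 6), (3, 7), (5, 8)]),
   (265414433537228307707904, [(1, 4), (2, 6), (3, 8), (5, 7)])]

def lookupTable (A : ℕ) : List (ℕ × List (ℕ × ℕ)) → Option (List (ℕ × ℕ))
  | [] => none
  | e :: l => match Nat.beq A e.1 with
    | true => some e.2
    | false => lookupTable A l

/-- Test applied to each complete graph reached by `explore`. -/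
def leafOK (n A : ℕ) : Bool :=
  match lookupTable A exceptional with
  | none => hasModel n A
  | some F =>
    allB (fun p => !bitAt A p.1 p.2 || F.contains p ||
      force (Nat.xor A (pairMask p.1 p.2)) fun A' => hasModel n A') (pairList n) &&
    allB (sublistOK n A F) F.sublists

/-- Row `i` shows that the graph need not be considered. -/
def prunable (n A i : ℕ) : Bool :=
  (Nat.ble (rowCount A i + 7) n && anyB (fun a => Nat.ble (rowCount A a + 7) n && !bitAt A a i)
    (List.range i)) ||
  Nat.ble (Nat.succ (rowCount A i)) (rowCount A 0) ||
  (Nat.beq i 0 && Nat.beq n 9 && Nat.beq (rowCount A 0) 3)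

/-- Vertex `i` has as many neighbours as allowed. -/
def full (n A i : ℕ) : Bool := Nat.ble n (Nat.add (rowCount A i) 6)

/-- Run through the graphs on `n` vertices with maximum degree at most `n - 6`, up to relabelling,
and check `leafOK`. The state is the partial code `A`; the pair `ij` is to be decided next, and `k`
is the number of vertices reached so far. -/
def explore (n : ℕ) : ℕ → (A i j k : ℕ) → Bool
  | 0, _, _, _, _ => false
  | fuel + 1, A, i, j, k =>
    force (Nat.succ i) fun i' =>
    match Nat.ble (Nat.succ j) k with
    | true =>
      force (Nat.succ j) fun j' =>
      (full n A i || full n A j ||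
        force (Nat.lor A (pairMask i j)) fun A' => explore n fuel A' i j' k) &&
          explore n fuel A i j' k
    | false =>
      force (Nat.succ k) fun k' =>
      (Nat.ble n k || full n A i ||
        force (Nat.lor A (pairMask i k)) fun A' => explore n fuel A' i k' k') &&
      (prunable n A i ||
        (match Nat.ble (Nat.succ i') k with
        | true => force (Nat.succ i') fun j' => explore n fuel A i' j' k
        | false => (match Nat.beq k n with
          | true => leafOK n A
          | false => force (Nat.succ i') fun j' => explore n fuel A i' j' k')))

@[simp] theorem force_eq (x : ℕ) (f : ℕ → Bool) : force x f = f x := by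
  cases x <;> rfl

@[simp] theorem anyB_eq_true {α : Type} (p : α → Bool) (l : List α) :
    anyB p l = true ↔ ∃ a ∈ l, p a = true := by
  induction l with
  | nil => simp [anyB]
  | cons a l ih => simp [anyB, ih]

@[simp] theorem allB_eq_true {α : Type} (p : α → Bool) (l : List α) :
    allB p l = true ↔ ∀ a ∈ l, p a = true := by
  induction l with
  | nil => simp [allB]
  | cons a l ih => simp [allB, ih]

theorem bitAt_eq (A a b : ℕ) : bitAt A a b = Nat.testBit A (9 * a + b) := by
  have h : bitAt A a b = Nat.beq (1 &&& (A >>> (9 * a + b))) 1 := rfl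
  rw [h, Nat.testBit, Nat.one_and_eq_mod_two]
  rcases Nat.mod_two_eq_zero_or_one (A >>> (9 * a + b)) with h | h <;> rw [h] <;> rfl

theorem bitAt_zero (a b : ℕ) : bitAt 0 a b = false := by simp [bitAt_eq]

theorem testBit_pairMask {i j a b : ℕ} (hi : i < 9) (hj : j < 9) (hb : b < 9) :
    Nat.testBit (pairMask i j) (9 * a + b) = decide ((a = i ∧ b = j) ∨ (a = j ∧ b = i)) := by
  have h : pairMask i j = (1 <<< (9 * i + j)) ||| (1 <<< (9 * j + i)) := rfl
  rw [h, Nat.testBit_or, Nat.one_shiftLeft, Nat.one_shiftLeft, Nat.testBit_two_pow,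
    Nat.testBit_two_pow, ← Bool.decide_or, decide_eq_decide]
  omega

theorem bitAt_lor {A i j a b : ℕ} (hi : i < 9) (hj : j < 9) (hb : b < 9) :
    bitAt (Nat.lor A (pairMask i j)) a b = true ↔
      bitAt A a b = true ∨ (a = i ∧ b = j) ∨ (a = j ∧ b = i) := by
  have h : Nat.lor A (pairMask i j) = A ||| pairMask i j := rfl
  rw [h, bitAt_eq, bitAt_eq, Nat.testBit_or, testBit_pairMask hi hj hb]
  simp

theorem bitAt_xor {A i j a b : ℕ} (hi : i < 9) (hj : j < 9) (hb : b < 9) :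
    bitAt (Nat.xor A (pairMask i j)) a b =
      (bitAt A a b ^^ decide ((a = i ∧ b = j) ∨ (a = j ∧ b = i))) := by
  have h : Nat.xor A (pairMask i j) = A ^^^ pairMask i j := rfl
  rw [h, bitAt_eq, bitAt_eq, Nat.testBit_xor, testBit_pairMask hi hj hb]

theorem popCount_eq : ∀ r < 512,
    popCount r = ((Finset.range 9).filter fun b => Nat.testBit r b = true).card := by
  decide +kernel

theorem rowCount_eq (A a : ℕ) :
    rowCount A a = ((Finset.range 9).filter fun b => bitAt A a b = true).card := by
  have h : rowCount A a = popCount ((A >>> (9 * a)) % 512) := rfl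
  rw [h, popCount_eq _ (Nat.mod_lt _ (by norm_num)), show 512 = 2 ^ 9 from rfl]
  congr 1
  refine Finset.filter_congr fun b hb => ?_
  rw [bitAt_eq, Nat.testBit_mod_two_pow, Nat.testBit_shiftRight]
  simp [Finset.mem_range.1 hb]

section Models

variable {α : Type} {H : SimpleGraph α} {φ : ℕ → α} {n A : ℕ}

theorem connected_induce_singleton (H : SimpleGraph α) (x : α) :
    (H.induce {x}).Connected where
  preconnected := by
    rintro ⟨y, hy⟩ ⟨z, hz⟩
    obtain rfl : y = _ := hy
    obtain rfl : z = _ := hz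
    exact Reachable.refl _
  nonempty := ⟨⟨x, rfl⟩⟩

theorem connected_of_bagConnected
    (hH : ∀ a < n, ∀ b < n, nonAdj A a b = true → H.Adj (φ a) (φ b)) :
    ∀ l : List ℕ, (∀ a ∈ l, a < n) → bagConnected A l = true →
      (H.induce (φ '' {a | a ∈ l})).Connected
  | [], _, h => by simp [bagConnected] at h
  | [a], _, _ => by
    have : φ '' {b | b ∈ [a]} = {φ a} := by simp
    rw [this]
    exact connected_induce_singleton H (φ a)
  | a :: b :: l, hl, h => by
    simp only [bagConnected, Bool.and_eq_true, anyB_eq_true] at h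
    obtain ⟨⟨c, hc, hac⟩, hr⟩ := h
    have ih := connected_of_bagConnected hH (b :: l)
      (fun x hx => hl x (List.mem_cons_of_mem _ hx)) hr
    have he : φ '' {x | x ∈ a :: b :: l} = {φ a} ∪ φ '' {x | x ∈ b :: l} := by
      rw [← Set.image_singleton, ← Set.image_union]
      congr 1
      ext x
      simp
    rw [he]
    exact connected_induce_union (connected_induce_singleton H (φ a)).preconnected
      ih.preconnected rfl ⟨c, hc, rfl⟩
      (hH a (hl a (by simp)) c (hl c (List.mem_cons_of_mem _ hc)) hac)

theorem bagsPairwise_iff (L : List (List ℕ)) : bagsPairwise A L = true ↔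
    L.Pairwise fun l m => bagsTouch A l m = true ∧ bagsDisjoint l m = true := by
  induction L with
  | nil => simp [bagsPairwise]
  | cons l L ih => simp [bagsPairwise, ih]

theorem minorOf_of_isModel (hφ : ∀ a < n, ∀ b < n, φ a = φ b → a = b)
    (hH : ∀ a < n, ∀ b < n, nonAdj A a b = true → H.Adj (φ a) (φ b))
    {L : List (List ℕ)} (hL : isModel n A L = true) :
    (⊤ : SimpleGraph (Fin 6)).MinorOf H := by
  simp only [isModel, Bool.and_eq_true, allB_eq_true, Nat.beq_eq, Nat.ble_eq,
    bagsPairwise_iff] at hL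
  obtain ⟨⟨hlen, hbag⟩, hpair⟩ := hL
  have hlt : ∀ w : Fin 6, (w : ℕ) < L.length := fun w => by omega
  have hmem : ∀ w : Fin 6, L[(w : ℕ)]'(hlt w) ∈ L := fun w => List.getElem_mem _
  have hpw : ∀ v w : Fin 6, v < w →
      bagsTouch A (L[(v : ℕ)]'(hlt v)) (L[(w : ℕ)]'(hlt w)) = true ∧
      bagsDisjoint (L[(v : ℕ)]'(hlt v)) (L[(w : ℕ)]'(hlt w)) = true := fun v w hvw =>
    List.pairwise_iff_getElem.1 hpair _ _ (hlt v) (hlt w) hvw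
  have hdis : ∀ v w : Fin 6, v < w → Disjoint (φ '' {a | a ∈ L[(v : ℕ)]'(hlt v)})
      (φ '' {a | a ∈ L[(w : ℕ)]'(hlt w)}) := by
    intro v w hvw
    rw [Set.disjoint_left]
    rintro _ ⟨a, ha, rfl⟩ ⟨b, hb, hab⟩
    have h := (hpw v w hvw).2
    simp only [bagsDisjoint, allB_eq_true, Bool.not_eq_true', ← Bool.not_eq_true,
      Nat.beq_eq] at h
    exact h a ha b hb (hφ b ((hbag _ (hmem w)).2 b hb) a ((hbag _ (hmem v)).2 a ha) hab).symm
  have hadj : ∀ v w : Fin 6, v < w → ∃ x ∈ φ '' {a | a ∈ L[(v : ℕ)]'(hlt v)},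
      ∃ y ∈ φ '' {a | a ∈ L[(w : ℕ)]'(hlt w)}, H.Adj x y := by
    intro v w hvw
    have h := (hpw v w hvw).1
    simp only [bagsTouch, anyB_eq_true] at h
    obtain ⟨a, ha, b, hb, hab⟩ := h
    exact ⟨_, ⟨a, ha, rfl⟩, _, ⟨b, hb, rfl⟩,
      hH a ((hbag _ (hmem v)).2 a ha) b ((hbag _ (hmem w)).2 b hb) hab⟩
  have hconn : ∀ w : Fin 6, (H.induce (φ '' {a | a ∈ L[(w : ℕ)]'(hlt w)})).Connected :=
    fun w => connected_of_bagConnected hH _ (hbag _ (hmem w)).2 (hbag _ (hmem w)).1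
  refine ⟨fun w => φ '' {a | a ∈ L[(w : ℕ)]'(hlt w)}, fun w => ?_, hconn, ?_, ?_⟩
  · exact Set.nonempty_coe_sort.1 (hconn w).nonempty
  · intro v w hvw
    rcases lt_or_gt_of_ne hvw with h | h
    · exact hdis v w h
    · exact (hdis w v h).symm
  · intro v w hvw
    rcases lt_or_gt_of_ne hvw.ne with h | h
    · exact hadj v w h
    · obtain ⟨x, hx, y, hy, hxy⟩ := hadj w v h
      exact ⟨y, hy, x, hx, hxy.symm⟩

end Models

theorem exists_isModel_of_growBags {n A S : ℕ} : ∀ (fuel rest ws budget mask cj : ℕ)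
    (bag : List ℕ) (bags : List (List ℕ)) (masks : List ℕ),
    growBags n A S fuel rest ws budget mask cj bag bags masks = true →
      ∃ L, isModel n A L = true
  | 0, _, _, _, _, _, _, _, _, h => by simp [growBags] at h
  | fuel + 1, rest, ws, budget, mask, cj, bag, bags, masks, h => by
    simp only [growBags, force_eq, Bool.and_eq_true, Bool.or_eq_true] at h
    rcases h.2 with (⟨-, h⟩ | ⟨-, h⟩) | h
    · split at h
      · exact ⟨_, h⟩
      · exact exists_isModel_of_growBags _ _ _ _ _ _ _ _ _ h
    · exact exists_isModel_of_growBags _ _ _ _ _ _ _ _ _ h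
    · exact exists_isModel_of_growBags _ _ _ _ _ _ _ _ _ h

theorem exists_isModel_of_chooseSingles {n A : ℕ} : ∀ (fuel cand S s rest : ℕ)
    (bags : List (List ℕ)), chooseSingles n A fuel cand S s rest bags = true →
      ∃ L, isModel n A L = true
  | 0, _, _, _, _, _, h => by simp [chooseSingles] at h
  | fuel + 1, cand, S, s, rest, bags, h => by
    simp only [chooseSingles, force_eq] at h
    split at h
    · simp only [Bool.and_eq_true] at h
      replace h := h.2
      split at h
      · exact ⟨_, h⟩
      · simp only [Bool.and_eq_true] at h
        exact exists_isModel_of_growBags _ _ _ _ _ _ _ _ _ h.2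
    · rw [Bool.or_eq_true] at h
      rcases h with h | h <;> exact exists_isModel_of_chooseSingles _ _ _ _ _ _ h

theorem exists_isModel_of_hasModel {n A : ℕ} (h : hasModel n A = true) :
    ∃ L, isModel n A L = true := by
  rw [hasModel, force_eq] at h
  exact exists_isModel_of_chooseSingles _ _ _ _ _ _ h

section Exploration

variable {α : Type} [Fintype α] {J : SimpleGraph α} [DecidableRel J.Adj]
  {φ : ℕ → α} {n A i j k : ℕ}

/-- The adjacency code `A` on `φ 0, …, φ (k - 1)` is a partial breadth-first record of `J` in which
the rows before `i` are complete and row `i` has been scanned up to column `j`. -/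
structure IsRecord (J : SimpleGraph α) [DecidableRel J.Adj] (φ : ℕ → α) (A i j k : ℕ) : Prop where
  inj : ∀ a < k, ∀ b < k, φ a = φ b → a = b
  symm : ∀ a < 9, ∀ b < 9, bitAt A a b = true → bitAt A b a = true
  adj : ∀ a < 9, ∀ b < 9, bitAt A a b = true → a < k ∧ b < k ∧ J.Adj (φ a) (φ b)
  fresh : ∀ a < 9, ∀ b < 9, bitAt A a b = true → a ≤ b → a < i ∨ a = i ∧ b < j
  done : ∀ a < i, ∀ u, J.Adj (φ a) u → ∃ b < k, φ b = u ∧ bitAt A a b = true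
  cur : ∀ b < j, J.Adj (φ i) (φ b) → bitAt A i b = true
  root : ∀ u, J.degree (φ 0) ≤ J.degree u

namespace IsRecord

theorem card_image_row [DecidableEq α] (h : IsRecord J φ A i j k) {a : ℕ} (ha : a < 9) :
    (((Finset.range 9).filter fun b => bitAt A a b = true).image φ).card = rowCount A a := by
  rw [rowCount_eq, Finset.card_image_of_injOn]
  intro b hb c hc hbc
  simp only [Finset.coe_filter, Finset.mem_range, Set.mem_ofPred_eq] at hb hc
  exact h.inj b (h.adj a ha b hb.1 hb.2).2.1 c (h.adj a ha c hc.1 hc.2).2.1 hbc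

theorem image_row_subset [DecidableEq α] (h : IsRecord J φ A i j k) {a : ℕ} (ha : a < 9) :
    ((Finset.range 9).filter fun b => bitAt A a b = true).image φ ⊆ J.neighborFinset (φ a) := by
  intro u hu
  simp only [Finset.mem_image, Finset.mem_filter, Finset.mem_range] at hu
  obtain ⟨b, ⟨hb, hab⟩, rfl⟩ := hu
  exact (J.mem_neighborFinset _ _).2 (h.adj a ha b hb hab).2.2

theorem rowCount_lt (h : IsRecord J φ A i j k) {a : ℕ} (ha : a < 9) {u : α}
    (hu : J.Adj (φ a) u) (hn : ∀ b < 9, bitAt A a b = true → φ b ≠ u) :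
    rowCount A a < J.degree (φ a) := by
  classical
  rw [← h.card_image_row ha, ← J.card_neighborFinset_eq_degree]
  refine Finset.card_lt_card ((Finset.ssubset_iff_of_subset (h.image_row_subset ha)).2
    ⟨u, (J.mem_neighborFinset _ _).2 hu, fun hm => ?_⟩)
  simp only [Finset.mem_image, Finset.mem_filter, Finset.mem_range] at hm
  obtain ⟨b, ⟨hb, hab⟩, rfl⟩ := hm
  exact hn b hb hab rfl

theorem rowCount_eq_degree (h : IsRecord J φ A i j k) (hk : k ≤ 9) {a : ℕ} (ha : a < 9)
    (hd : ∀ u, J.Adj (φ a) u → ∃ b < k, φ b = u ∧ bitAt A a b = true) :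
    rowCount A a = J.degree (φ a) := by
  classical
  rw [← h.card_image_row ha, ← J.card_neighborFinset_eq_degree]
  congr 1
  refine (h.image_row_subset ha).antisymm fun u hu => ?_
  obtain ⟨b, hb, rfl, hab⟩ := hd u ((J.mem_neighborFinset _ _).1 hu)
  exact Finset.mem_image_of_mem _ (by simp [hab]; omega)

theorem step_of_adj (h : IsRecord J φ A i j k) (hij : i < j) (hjk : j < k) (hk : k ≤ 9)
    (ha : J.Adj (φ i) (φ j)) : IsRecord J φ (Nat.lor A (pairMask i j)) i (j + 1) k where
  inj := h.inj
  symm a ha b hb hab := by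
    rw [bitAt_lor (by omega) (by omega) hb] at hab
    rw [bitAt_lor (by omega) (by omega) ha]
    have := h.symm a ha b hb
    tauto
  adj a ha' b hb hab := by
    rw [bitAt_lor (by omega) (by omega) hb] at hab
    rcases hab with hab | ⟨rfl, rfl⟩ | ⟨rfl, rfl⟩
    · exact h.adj a ha' b hb hab
    · exact ⟨by omega, by omega, ha⟩
    · exact ⟨by omega, by omega, ha.symm⟩
  fresh a ha' b hb hab hle := by
    rw [bitAt_lor (by omega) (by omega) hb] at hab
    rcases hab with hab | ⟨rfl, rfl⟩ | ⟨rfl, rfl⟩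
    · have := h.fresh a ha' b hb hab hle
      omega
    · omega
    · omega
  done a ha' u hu := by
    obtain ⟨b, hb, hbu, hab⟩ := h.done a ha' u hu
    exact ⟨b, hb, hbu, (bitAt_lor (by omega) (by omega) (by omega)).2 (Or.inl hab)⟩
  cur b hb hib := by
    rw [bitAt_lor (by omega) (by omega) (by omega)]
    rcases Nat.lt_succ_iff_lt_or_eq.1 hb with hb | rfl
    · exact Or.inl (h.cur b hb hib)
    · simp
  root := h.root

theorem step_of_not_adj (h : IsRecord J φ A i j k) (ha : ¬ J.Adj (φ i) (φ j)) :
    IsRecord J φ A i (j + 1) k where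
  inj := h.inj
  symm := h.symm
  adj := h.adj
  fresh a ha' b hb hab hle := by
    have := h.fresh a ha' b hb hab hle
    omega
  done := h.done
  cur b hb hib := by
    rcases Nat.lt_succ_iff_lt_or_eq.1 hb with hb | rfl
    · exact h.cur b hb hib
    · exact absurd hib ha
  root := h.root

theorem update (h : IsRecord J φ A i j k) (hij : i < j) (hjk : j ≤ k) (hk : k < 9) {u : α}
    (hu : ∀ b < k, φ b ≠ u) : IsRecord J (Function.update φ k u) A i j (k + 1) := by
  have hne : ∀ b < k, Function.update φ k u b = φ b := fun b hb =>
    Function.update_of_ne (by omega) _ _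
  refine ⟨?_, h.symm, ?_, h.fresh, ?_, ?_, ?_⟩
  · intro a ha b hb hab
    rcases Nat.lt_succ_iff_lt_or_eq.1 ha with ha | rfl <;>
      rcases Nat.lt_succ_iff_lt_or_eq.1 hb with hb | rfl
    · rw [hne a ha, hne b hb] at hab
      exact h.inj a ha b hb hab
    · rw [hne a ha, Function.update_self] at hab
      exact absurd hab (hu a ha)
    · rw [hne b hb, Function.update_self] at hab
      exact absurd hab.symm (hu b hb)
    · rfl
  · intro a ha b hb hab
    obtain ⟨h1, h2, h3⟩ := h.adj a ha b hb hab
    rw [hne a h1, hne b h2]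
    exact ⟨by omega, by omega, h3⟩
  · intro a ha v hv
    rw [hne a (by omega)] at hv
    obtain ⟨b, hb, hbv, hab⟩ := h.done a ha v hv
    exact ⟨b, by omega, by rw [hne b hb, hbv], hab⟩
  · intro b hb hib
    rw [hne i (by omega), hne b (by omega)] at hib
    exact h.cur b hb hib
  · rw [hne 0 (by omega)]
    exact h.root

theorem next_row (h : IsRecord J φ A i j k) (hi : i + 1 < k) (hk : k ≤ 9)
    (hd : ∀ u, J.Adj (φ i) u → ∃ b < k, φ b = u ∧ bitAt A i b = true) :
    IsRecord J φ A (i + 1) (i + 2) k := by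
  have hd' : ∀ a < i + 1, ∀ u, J.Adj (φ a) u → ∃ b < k, φ b = u ∧ bitAt A a b = true := by
    intro a ha
    rcases Nat.lt_succ_iff_lt_or_eq.1 ha with ha | rfl
    · exact h.done a ha
    · exact hd
  refine ⟨h.inj, h.symm, h.adj, ?_, hd', ?_, h.root⟩
  · intro a ha b hb hab hle
    have := h.fresh a ha b hb hab hle
    omega
  · intro b hb hib
    rcases Nat.lt_succ_iff_lt_or_eq.1 hb with hb | rfl
    · obtain ⟨c, hc, hcu, hbc⟩ := hd' b hb _ hib.symm
      rw [h.inj c hc (i + 1) hi hcu] at hbc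
      exact h.symm b (by omega) (i + 1) (by omega) hbc
    · exact absurd hib (J.irrefl)

theorem not_prunable (h : IsRecord J φ A i j k) (hi : i < k) (hk : k ≤ 9)
    (hd : ∀ u, J.Adj (φ i) u → ∃ b < k, φ b = u ∧ bitAt A i b = true)
    (hmax : ∀ a b, a ≠ b → ¬ J.Adj a b → n ≤ J.degree a + 6 ∨ n ≤ J.degree b + 6)
    (hodd : n = 9 → ∀ v, (∀ u, J.degree v ≤ J.degree u) → J.degree v ≠ 3) :
    prunable n A i = false := by
  have hd' : ∀ a ≤ i, rowCount A a = J.degree (φ a) := by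
    intro a ha
    refine h.rowCount_eq_degree hk (by omega) ?_
    rcases Nat.lt_or_eq_of_le ha with ha | rfl
    · exact h.done a ha
    · exact hd
  rw [← Bool.not_eq_true]
  intro hp
  simp only [prunable, Bool.or_eq_true, Bool.and_eq_true, anyB_eq_true, Nat.ble_eq, List.mem_range,
    Nat.beq_eq, Bool.not_eq_true'] at hp
  rcases hp with (⟨h1, a, ha, h2, h3⟩ | h1) | ⟨⟨rfl, h1⟩, h2⟩
  · rw [hd' i le_rfl] at h1
    rw [hd' a ha.le] at h2
    have hna : ¬ J.Adj (φ a) (φ i) := by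
      intro hadj
      obtain ⟨b, hb, hbi, hab⟩ := h.done a ha _ hadj
      rw [h.inj b hb i hi hbi] at hab
      simp [hab] at h3
    rcases hmax (φ a) (φ i) (fun he => by
      have := h.inj a (by omega) i hi he
      omega) hna with h4 | h4 <;> omega
  · rw [hd' i le_rfl, hd' 0 (by omega)] at h1
    have := h.root (φ i)
    omega
  · rw [hd' 0 le_rfl] at h2
    exact hodd h1 _ h.root h2

end IsRecord

theorem exists_leafOK_of_explore (hn : Fintype.card α = n) (hn9 : n ≤ 9)
    (hcap : ∀ v, J.degree v + 6 ≤ n)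
    (hmax : ∀ a b, a ≠ b → ¬ J.Adj a b → n ≤ J.degree a + 6 ∨ n ≤ J.degree b + 6)
    (hodd : n = 9 → ∀ v, (∀ u, J.degree v ≤ J.degree u) → J.degree v ≠ 3) :
    ∀ (fuel A i j k : ℕ) (φ : ℕ → α), explore n fuel A i j k = true → i < j → j ≤ k → k ≤ n →
      IsRecord J φ A i j k →
      ∃ (ψ : ℕ → α) (B : ℕ), (∀ a < n, ∀ b < n, ψ a = ψ b → a = b) ∧
        (∀ a < n, ∀ b < n, bitAt B a b = true ↔ J.Adj (ψ a) (ψ b)) ∧ leafOK n B = true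
  | 0, _, _, _, _, _, h, _, _, _, _ => by simp [explore] at h
  | fuel + 1, A, i, j, k, φ, h, hij, hjk, hkn, hs => by
    classical
    have ih := exists_leafOK_of_explore hn hn9 hcap hmax hodd fuel
    have hfull : ∀ a < k, ∀ u, J.Adj (φ a) u → (∀ b < 9, bitAt A a b = true → φ b ≠ u) →
        full n A a = false := by
      intro a ha u hu hb
      have h1 := hs.rowCount_lt (by omega) hu hb
      have h2 := hcap (φ a)
      rw [← Bool.not_eq_true]
      simp only [full, Nat.add_eq, Nat.ble_eq]
      omega
    simp only [explore, force_eq] at h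
    split at h
    · rename_i hlt
      have hlt : j < k := Nat.le_of_ble_eq_true hlt
      simp only [Bool.and_eq_true, Bool.or_eq_true] at h
      by_cases hadj : J.Adj (φ i) (φ j)
      · have hij0 : bitAt A i j = true → False := fun hb => by
          have := hs.fresh i (by omega) j (by omega) hb hij.le
          omega
        have h1 := hfull i (by omega) _ hadj (fun b hb hib he => by
          have := hs.inj b (hs.adj i (by omega) b hb hib).2.1 j hlt he
          exact hij0 (this ▸ hib))
        have h2 := hfull j (by omega) _ hadj.symm (fun b hb hib he => by
          have := hs.inj b (hs.adj j (by omega) b hb hib).2.1 i (by omega) he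
          exact hij0 (hs.symm j (by omega) i (by omega) (this ▸ hib)))
        rw [h1, h2] at h
        exact ih _ _ _ _ _ (by simpa using h.1) (by omega) hlt hkn
          (hs.step_of_adj hij hlt (by omega) hadj)
      · exact ih _ _ _ _ _ h.2 (by omega) hlt hkn (hs.step_of_not_adj hadj)
    · rename_i hlt
      have hjk' : j = k := by
        have : ¬ j + 1 ≤ k := fun hle => by
          rw [Nat.ble_eq_true_of_le hle] at hlt
          cases hlt
        omega
      subst hjk'
      simp only [Bool.and_eq_true, Bool.or_eq_true] at h
      obtain ⟨hext, hrow⟩ := h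
      by_cases hx : ∃ u, J.Adj (φ i) u ∧ ∀ b < j, φ b ≠ u
      · obtain ⟨u, hu, hub⟩ := hx
        have hjn : j < n := by
          have h1 : ((insert u ((Finset.range j).image φ)) : Finset α).card = j + 1 := by
            rw [Finset.card_insert_of_notMem, Finset.card_image_of_injOn, Finset.card_range]
            · intro a ha b hb
              exact hs.inj a (by simpa using ha) b (by simpa using hb)
            · simpa using hub
          have h2 := Finset.card_le_univ (insert u ((Finset.range j).image φ))
          omega
        have h1 := hfull i hij u hu (fun b hb hib => hub b (hs.adj i (by omega) b hb hib).2.1)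
        rw [h1] at hext
        have hs' := hs.update hij le_rfl (by omega) hub
        refine ih _ _ _ _ _ (hext.resolve_left ?_) (by simp; omega) (by simp) hjn
          (hs'.step_of_adj hij (by omega) (by omega) ?_)
        · simp only [Nat.ble_eq, Bool.false_eq_true, or_false]
          omega
        · rw [Function.update_self, Function.update_of_ne (by omega)]
          exact hu
      · push Not at hx
        have hd : ∀ u, J.Adj (φ i) u → ∃ b < j, φ b = u ∧ bitAt A i b = true := by
          intro u hu
          obtain ⟨b, hb, rfl⟩ := hx u hu
          exact ⟨b, hb, rfl, hs.cur b hb hu⟩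
        rw [hs.not_prunable hij (by omega) hd hmax hodd] at hrow
        replace hrow := hrow.resolve_left (by simp)
        split at hrow
        · rename_i hlt'
          have hlt' : i + 1 < j := Nat.le_of_ble_eq_true hlt'
          exact ih _ _ _ _ _ hrow (by simp) hlt' hkn (hs.next_row hlt' (by omega) hd)
        · rename_i hlt'
          have hji : j = i + 1 := by
            have : ¬ i + 1 + 1 ≤ j := fun hle => by
              rw [Nat.ble_eq_true_of_le hle] at hlt'
              cases hlt'
            omega
          have hd' : ∀ a < j, ∀ u, J.Adj (φ a) u → ∃ b < j, φ b = u ∧ bitAt A a b = true := by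
            intro a ha
            rw [hji] at ha
            rcases Nat.lt_succ_iff_lt_or_eq.1 ha with ha | rfl
            · exact hs.done a ha
            · exact hd
          split at hrow
          · rename_i heq
            obtain rfl : j = n := by simpa using heq
            refine ⟨φ, A, hs.inj, fun a ha b hb => ⟨fun hab => ?_, fun hab => ?_⟩, hrow⟩
            · exact (hs.adj a (by omega) b (by omega) hab).2.2
            · obtain ⟨c, hc, hcb, hac⟩ := hd' a ha _ hab
              rwa [hs.inj c hc b hb hcb] at hac
          · rename_i heq
            have hjn : j < n := by
              have : j ≠ n := fun he => by simp [he] at heq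
              omega
            obtain ⟨u, hu⟩ : ∃ u, u ∉ (Finset.range j).image φ := by
              by_contra! hcon
              have h1 : Finset.univ ⊆ (Finset.range j).image φ := fun u _ => hcon u
              have h2 := (Finset.card_le_card h1).trans Finset.card_image_le
              rw [Finset.card_univ, Finset.card_range] at h2
              omega
            have hub : ∀ b < j, φ b ≠ u := by simpa using hu
            have hs' := hs.update hij le_rfl (by omega) hub
            refine ih _ _ _ _ _ hrow (by simp) (by simp; omega) hjn
              (hs'.next_row (by omega) (by omega) ?_)
            intro v hv
            rw [Function.update_of_ne (by omega)] at hv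
            obtain ⟨b, hb, hbv, hib⟩ := hd v hv
            exact ⟨b, by omega, by rw [Function.update_of_ne (by omega), hbv], hib⟩

end Exploration

theorem explore_six : explore 6 40 0 0 1 1 = true := by decide +kernel

theorem explore_seven : explore 7 40 0 0 1 1 = true := by decide +kernel

theorem explore_eight : explore 8 40 0 0 1 1 = true := by decide +kernel

theorem explore_nine : explore 9 40 0 0 1 1 = true := by decide +kernel

theorem exists_mem_of_lookupTable {A : ℕ} {F : List (ℕ × ℕ)} :
    ∀ l : List (ℕ × List (ℕ × ℕ)), lookupTable A l = some F → ∃ e ∈ l, e.2 = F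
  | [], h => by simp [lookupTable] at h
  | e :: l, h => by
    rw [lookupTable] at h
    split at h
    · exact ⟨e, by simp, by simpa using h⟩
    · obtain ⟨e', he', hF⟩ := exists_mem_of_lookupTable l h
      exact ⟨e', List.mem_cons_of_mem _ he', hF⟩

theorem exceptional_valid : ∀ e ∈ exceptional, e.2.Nodup ∧ ∀ p ∈ e.2, p.1 < p.2 := by
  decide +kernel

theorem mem_pairList {n : ℕ} {p : ℕ × ℕ} : p ∈ pairList n ↔ p.1 < p.2 ∧ p.2 < n := by
  obtain ⟨a, b⟩ := p
  simp only [pairList, List.mem_flatMap, List.mem_range, List.mem_map, Prod.mk.injEq]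
  constructor
  · rintro ⟨b', hb, a', ha, rfl, rfl⟩
    exact ⟨ha, hb⟩
  · rintro ⟨ha, hb⟩
    exact ⟨b, hb, a, ha, rfl, rfl⟩

section DenseGraphs

variable {α : Type}

theorem sum_card_filter_adj_le {J : SimpleGraph α} [DecidableRel J.Adj] {S : Finset α}
    {ψ : ℕ → α} {D : List (ℕ × ℕ)}
    (h : ∀ x ∈ S, ∀ y ∈ S, J.Adj x y → ∃ a b, ψ a = x ∧ ψ b = y ∧ ((a, b) ∈ D ∨ (b, a) ∈ D)) :
    ∑ v ∈ S, (S.filter (J.Adj v)).card ≤ 2 * D.length := by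
  classical
  have h1 : ∑ v ∈ S, (S.filter (J.Adj v)).card =
      ((S ×ˢ S).filter fun p => J.Adj p.1 p.2).card := by
    simp only [Finset.card_filter, Finset.sum_product]
  have h2 : (S ×ˢ S).filter (fun p => J.Adj p.1 p.2) ⊆
      D.toFinset.image (fun p => (ψ p.1, ψ p.2)) ∪ D.toFinset.image (fun p => (ψ p.2, ψ p.1)) := by
    rintro ⟨x, y⟩ hp
    simp only [Finset.mem_filter, Finset.mem_product] at hp
    obtain ⟨a, b, rfl, rfl, hab | hab⟩ := h x hp.1.1 y hp.1.2 hp.2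
    · exact Finset.mem_union_left _ (Finset.mem_image.2 ⟨_, List.mem_toFinset.2 hab, rfl⟩)
    · exact Finset.mem_union_right _ (Finset.mem_image.2 ⟨_, List.mem_toFinset.2 hab, rfl⟩)
  have h3 := (Finset.card_le_card h2).trans (Finset.card_union_le _ _)
  have h4 := (Finset.card_image_le (s := D.toFinset) (f := fun p => (ψ p.1, ψ p.2)))
  have h5 := (Finset.card_image_le (s := D.toFinset) (f := fun p => (ψ p.2, ψ p.1)))
  have h6 := List.toFinset_card_le D
  omega

theorem incident_le {J : SimpleGraph α} [DecidableRel J.Adj] {S : Finset α} {ψ : ℕ → α} {n : ℕ}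
    (hψ : ∀ a < n, ∀ b < n, ψ a = ψ b → a = b) {D : List (ℕ × ℕ)} (hD : D.Nodup)
    (h : ∀ p ∈ D, p.1 < p.2 ∧ p.2 < n ∧ J.Adj (ψ p.1) (ψ p.2) ∧ ψ p.1 ∈ S ∧ ψ p.2 ∈ S) (v : ℕ) :
    incident D v ≤ (S.filter (J.Adj (ψ v))).card := by
  classical
  rw [incident, List.countP_eq_length_filter, ← List.toFinset_card_of_nodup (hD.filter _)]
  refine Finset.card_le_card_of_injOn (fun p => ψ (if p.1 = v then p.2 else p.1)) ?_ ?_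
  · rintro ⟨a, b⟩ hp
    simp only [Finset.mem_coe, List.mem_toFinset, List.mem_filter, Bool.or_eq_true,
      beq_iff_eq] at hp
    obtain ⟨h1, h2, h3, h4, h5⟩ := h _ hp.1
    simp only [Finset.coe_filter, Set.mem_ofPred_eq]
    by_cases hav : a = v
    · subst hav
      simpa using ⟨h5, h3⟩
    · have hbv : b = v := hp.2.resolve_left hav
      subst hbv
      simpa [hav] using ⟨h4, h3.symm⟩
  · rintro ⟨a, b⟩ hp ⟨c, d⟩ hq hpq
    simp only [Finset.mem_coe, List.mem_toFinset, List.mem_filter, Bool.or_eq_true,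
      beq_iff_eq] at hp hq hpq
    have hp' := h _ hp.1
    have hq' := h _ hq.1
    simp only at hp' hq'
    have := hψ _ (by split <;> omega) _ (by split <;> omega) hpq
    simp only [Prod.mk.injEq]
    split at this <;> split at this <;> omega

variable [Fintype α]

theorem exists_le_saturated {n : ℕ} (J : SimpleGraph α) (hdeg : ∀ v, (J.neighborSet v).ncard ≤ n) :
    ∃ K : SimpleGraph α, J ≤ K ∧ (∀ v, (K.neighborSet v).ncard ≤ n) ∧
      ∀ a b, a ≠ b → ¬ K.Adj a b →
        n ≤ (K.neighborSet a).ncard ∨ n ≤ (K.neighborSet b).ncard := by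
  classical
  obtain ⟨K, hJK, hK⟩ := Set.Finite.exists_le_maximal
    (s := {K : SimpleGraph α | ∀ v, (K.neighborSet v).ncard ≤ n}) (Set.toFinite _) hdeg
  refine ⟨K, hJK, hK.1, fun a b hab hnab => ?_⟩
  by_contra! hlt
  have hmem : ∀ v, ((K ⊔ edge a b).neighborSet v).ncard ≤ n := by
    intro v
    by_cases hv : v = a ∨ v = b
    · have hv' : (K.neighborSet v).ncard < n := by rcases hv with rfl | rfl <;> tauto
      have hsub : (K ⊔ edge a b).neighborSet v ⊆
          insert (if v = a then b else a) (K.neighborSet v) := by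
        intro w hw
        simp only [mem_neighborSet, sup_adj, edge_adj] at hw
        simp only [Set.mem_insert_iff, mem_neighborSet]
        rcases hw with hw | ⟨⟨rfl, rfl⟩ | ⟨rfl, rfl⟩, -⟩
        · exact Or.inr hw
        · simp
        · simp [hab.symm]
      have := (Set.ncard_le_ncard hsub).trans (Set.ncard_insert_le _ _)
      omega
    · have hsub : (K ⊔ edge a b).neighborSet v ⊆ K.neighborSet v := by
        intro w hw
        simp only [mem_neighborSet, sup_adj, edge_adj] at hw ⊢
        tauto
      exact (Set.ncard_le_ncard hsub).trans (hK.1 v)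
  have hle : K ⊔ edge a b ≤ K := hK.2 hmem le_sup_left
  exact hnab (hle (by simp [edge_adj, hab]))

theorem ncard_neighborSet_eq_degree (J : SimpleGraph α) [DecidableRel J.Adj] (v : α) :
    (J.neighborSet v).ncard = J.degree v := by
  rw [Set.ncard_eq_toFinset_card', ← card_neighborFinset_eq_degree, neighborFinset]

theorem exists_leafOK {n : ℕ} (hn : Fintype.card α = n) (h6 : 6 ≤ n) (h9 : n ≤ 9)
    (J : SimpleGraph α) (hdeg : ∀ v, (J.neighborSet v).ncard + 6 ≤ n) :
    ∃ (K : SimpleGraph α) (ψ : ℕ → α) (B : ℕ), J ≤ K ∧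
      (∀ a < n, ∀ b < n, ψ a = ψ b → a = b) ∧
      (∀ a < n, ∀ b < n, bitAt B a b = true ↔ K.Adj (ψ a) (ψ b)) ∧ leafOK n B = true := by
  classical
  obtain ⟨K, hJK, hK, hmax⟩ := exists_le_saturated (n := n - 6) J fun v => by
    have := hdeg v
    omega
  simp only [ncard_neighborSet_eq_degree] at hK hmax
  obtain ⟨r, -, hr⟩ := Finset.exists_min_image (Finset.univ : Finset α) (fun v => K.degree v)
    (Finset.univ_nonempty_iff.2 (Fintype.card_pos_iff.1 (by omega)))
  have hodd : n = 9 → ∀ v, (∀ u, K.degree v ≤ K.degree u) → K.degree v ≠ 3 := by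
    rintro rfl v hv h3
    have hall : ∀ u, K.degree u = 3 := fun u => by
      have h1 := hv u
      have h2 := hK u
      omega
    have hsum := K.sum_degrees_eq_twice_card_edges
    simp only [hall, Finset.sum_const, Finset.card_univ, hn, smul_eq_mul] at hsum
    omega
  have hex : explore n 40 0 0 1 1 = true := by
    interval_cases n
    exacts [explore_six, explore_seven, explore_eight, explore_nine]
  obtain ⟨ψ, B, h⟩ := exists_leafOK_of_explore (J := K) hn h9 (fun v => by
      have := hK v
      omega) (fun a b hab hnab => by
      have := hmax a b hab hnab
      omega) hodd 40 0 0 1 1 (fun _ => r) hex (by simp) le_rfl (by omega)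
    { inj := fun a ha b hb _ => by omega
      symm := fun a _ b _ h => by simp [bitAt_zero] at h
      adj := fun a _ b _ h => by simp [bitAt_zero] at h
      fresh := fun a _ b _ h => by simp [bitAt_zero] at h
      done := fun a ha => by omega
      cur := fun b _ h => absurd h K.irrefl
      root := fun u => hr u (Finset.mem_univ _) }
  exact ⟨K, ψ, B, hJK, h⟩

theorem minorOf_compl_or_edge (J : SimpleGraph α) [DecidableRel J.Adj]
    (h6 : 6 ≤ Fintype.card α) (h9 : Fintype.card α ≤ 9)
    (hdeg : ∀ v, (J.neighborSet v).ncard + 6 ≤ Fintype.card α) {S : Finset α} (hS : S.Nonempty)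
    (hJ : ∀ v ∈ S, 4 * (S.filter (J.Adj v)).card + 1 ≤ ∑ v ∈ S, (S.filter (J.Adj v)).card) :
    (⊤ : SimpleGraph (Fin 6)).MinorOf Jᶜ ∨
      ∃ p ∈ S, ∃ q ∈ S, p ≠ q ∧ (⊤ : SimpleGraph (Fin 6)).MinorOf (Jᶜ ⊔ edge p q) := by
  classical
  obtain ⟨n, hn⟩ : ∃ n, Fintype.card α = n := ⟨_, rfl⟩
  rw [hn] at h6 h9
  obtain ⟨K, ψ, B, hJK, hinj, hadj, hleaf⟩ := exists_leafOK hn h6 h9 J (by simpa [hn] using hdeg)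
  have hsurj : ∀ x, ∃ a < n, ψ a = x := by
    intro x
    have h1 : ((Finset.range n).image ψ) = Finset.univ := by
      apply Finset.eq_univ_of_card
      rw [Finset.card_image_of_injOn, Finset.card_range, hn]
      intro a ha b hb
      exact hinj a (by simpa using ha) b (by simpa using hb)
    have h2 := h1 ▸ Finset.mem_univ x
    simpa using h2
  have hcompl : ∀ a < n, ∀ b < n, nonAdj B a b = true → Jᶜ.Adj (ψ a) (ψ b) := by
    intro a ha b hb h
    simp only [nonAdj, Bool.and_eq_true, Bool.not_eq_true', ← Bool.not_eq_true, Nat.beq_eq] at h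
    rw [compl_adj]
    exact ⟨fun he => h.1 (hinj a ha b hb he), fun he => h.2 ((hadj a ha b hb).2 (hJK he))⟩
  rw [leafOK] at hleaf
  split at hleaf
  · obtain ⟨L, hL⟩ := exists_isModel_of_hasModel hleaf
    exact Or.inl (minorOf_of_isModel hinj hcompl hL)
  · rename_i F hF
    obtain ⟨e, he, rfl⟩ := exists_mem_of_lookupTable _ hF
    obtain ⟨hnd, hlt⟩ := exceptional_valid e he
    simp only [Bool.and_eq_true, allB_eq_true, Bool.or_eq_true, force_eq, List.contains_iff_mem,
      List.mem_sublists] at hleaf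
    obtain ⟨hedge, hsub⟩ := hleaf
    by_contra hcon
    have hmemF : ∀ p ∈ pairList n, bitAt B p.1 p.2 = true → ψ p.1 ∈ S → ψ p.2 ∈ S → p ∈ e.2 := by
      intro p hp hb h1 h2
      rcases hedge p hp with (h | h) | h
      · simp [hb] at h
      · exact h
      · exfalso
        rw [mem_pairList] at hp
        obtain ⟨L, hL⟩ := exists_isModel_of_hasModel h
        have hne : ψ p.1 ≠ ψ p.2 := fun h => by
          have := hinj _ (by omega) _ hp.2 h
          omega
        refine hcon (Or.inr ⟨_, h1, _, h2, hne, minorOf_of_isModel hinj ?_ hL⟩)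
        intro a ha b hb' hab
        rw [sup_adj]
        by_cases hold : nonAdj B a b = true
        · exact Or.inl (hcompl a ha b hb' hold)
        · right
          simp only [nonAdj, bitAt_xor (show p.1 < 9 by omega) (show p.2 < 9 by omega)
            (show b < 9 by omega)] at hab hold
          rw [edge_adj]
          by_cases hc : (a = p.1 ∧ b = p.2) ∨ (a = p.2 ∧ b = p.1)
          · rcases hc with ⟨rfl, rfl⟩ | ⟨rfl, rfl⟩
            · exact ⟨Or.inl ⟨rfl, rfl⟩, hne⟩
            · exact ⟨Or.inr ⟨rfl, rfl⟩, hne.symm⟩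
          · simp [hc] at hab hold
            simp [hab.1, hab.2] at hold
    set D := e.2.filter fun p => decide (p.2 < n ∧ J.Adj (ψ p.1) (ψ p.2) ∧ ψ p.1 ∈ S ∧ ψ p.2 ∈ S)
      with hDdef
    have hD : ∀ p ∈ D, p.1 < p.2 ∧ p.2 < n ∧ J.Adj (ψ p.1) (ψ p.2) ∧ ψ p.1 ∈ S ∧ ψ p.2 ∈ S := by
      intro p hp
      rw [hDdef, List.mem_filter, decide_eq_true_eq] at hp
      exact ⟨hlt p hp.1, hp.2⟩
    have hmemD : ∀ a < n, ∀ b < n, a < b → J.Adj (ψ a) (ψ b) → ψ a ∈ S → ψ b ∈ S → (a, b) ∈ D := by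
      intro a ha b hb hab hJab h1 h2
      rw [hDdef, List.mem_filter, decide_eq_true_eq]
      exact ⟨hmemF _ (mem_pairList.2 ⟨hab, hb⟩) ((hadj a ha b hb).2 (hJK hJab)) h1 h2,
        hb, hJab, h1, h2⟩
    have hle : ∑ v ∈ S, (S.filter (J.Adj v)).card ≤ 2 * D.length := by
      refine sum_card_filter_adj_le (ψ := ψ) fun x hx y hy hxy => ?_
      obtain ⟨a, ha, rfl⟩ := hsurj x
      obtain ⟨b, hb, rfl⟩ := hsurj y
      refine ⟨a, b, rfl, rfl, ?_⟩
      rcases lt_trichotomy a b with hab | rfl | hab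
      · exact Or.inl (hmemD a ha b hb hab hxy hx hy)
      · exact absurd hxy J.irrefl
      · exact Or.inr (hmemD b hb a ha hab hxy.symm hy hx)
    have hinc : ∀ v, incident D v ≠ 0 → ψ v ∈ S := by
      intro v hv
      rw [incident, ← Nat.pos_iff_ne_zero, List.countP_pos_iff] at hv
      obtain ⟨p, hp, hpv⟩ := hv
      have := hD p hp
      simp only [Bool.or_eq_true, beq_iff_eq] at hpv
      rcases hpv with rfl | rfl <;> tauto
    have hok := hsub D (hDdef ▸ List.filter_sublist)
    simp only [sublistOK, Bool.or_eq_true, List.isEmpty_iff, List.any_eq_true, Bool.and_eq_true,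
      bne_iff_ne, decide_eq_true_eq, Bool.not_eq_true', ← Bool.not_eq_true,
      List.contains_iff_mem] at hok
    rcases hok with (hnil | ⟨v, -, hv, hvD⟩) | ⟨p, hp, ⟨⟨hb, h1⟩, h2⟩, hnF⟩
    · obtain ⟨v, hv⟩ := hS
      have := hJ v hv
      simp only [hnil, List.length_nil] at hle
      omega
    · have h1 := incident_le hinj (show D.Nodup from hnd.filter _) hD v
      have h2 := hJ _ (hinc v hv)
      omega
    · exact hnF (hmemF p hp hb (hinc _ h1) (hinc _ h2))

end DenseGraphs

section Contraction

variable {V : Type}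

/-- The graph obtained from the subgraph of `G` induced on `B` by joining `v` to all of `T`. -/
def joinOn (G : SimpleGraph V) (B : Set V) (v : V) (T : Set V) : SimpleGraph V where
  Adj a b := a ≠ b ∧ a ∈ B ∧ b ∈ B ∧ (G.Adj a b ∨ (a = v ∧ b ∈ T) ∨ (b = v ∧ a ∈ T))
  symm := ⟨fun a b h => ⟨h.1.symm, h.2.2.1, h.2.1, by
    have := h.2.2.2
    rw [G.adj_comm] at this
    tauto⟩⟩
  loopless := ⟨fun a h => h.1 rfl⟩

theorem minorOf_mono {W : Type} {H : SimpleGraph W} {G G' : SimpleGraph V} (hle : G ≤ G')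
    (h : H.MinorOf G) : H.MinorOf G' := by
  obtain ⟨f, hne, hconn, hdis, hadj⟩ := h
  refine ⟨f, hne, fun w => (hconn w).mono (fun a b hab => hle hab), hdis, fun v w hvw => ?_⟩
  obtain ⟨a, ha, b, hb, hab⟩ := hadj v w hvw
  exact ⟨a, ha, b, hb, hle hab⟩

/-- Joining `v` to neighbours of a connected set `K` that is itself attached to `v` and avoids `B`
does not create a new complete minor. -/
theorem minorOf_of_minorOf_joinOn {W : Type} [Nontrivial W] {G : SimpleGraph V} {B T K : Set V}
    {v : V} (hK : (G.induce K).Connected) (hKB : Disjoint K B) (hv : ∃ k ∈ K, G.Adj v k)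
    (hT : ∀ t ∈ T, ∃ k ∈ K, G.Adj t k)
    (h : (⊤ : SimpleGraph W).MinorOf (joinOn G B v T)) : (⊤ : SimpleGraph W).MinorOf G := by
  classical
  obtain ⟨f, hne, hconn, hdis, hadj⟩ := h
  have hfB : ∀ w, f w ⊆ B := by
    intro w x hx
    obtain ⟨w', hw'⟩ := exists_ne w
    obtain ⟨a, ha, b, -, hab⟩ := hadj w w' hw'.symm
    have hr := (hconn w).preconnected ⟨a, ha⟩ ⟨x, hx⟩
    rw [reachable_iff_reflTransGen] at hr
    rcases hr.cases_tail with he | ⟨y, -, hy⟩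
    · obtain rfl : x = a := congrArg Subtype.val he
      exact hab.2.1
    · exact hy.2.2.1
  obtain ⟨k₀, hk₀, hvk₀⟩ := hv
  have hreach : ∀ (X : Set V) (hKX : K ⊆ X) (y : V) (hy : y ∈ X), (∃ k ∈ K, G.Adj y k) →
      (G.induce X).Reachable ⟨y, hy⟩ ⟨k₀, hKX hk₀⟩ := by
    rintro X hKX y hy ⟨k, hk, hyk⟩
    have h1 : (G.induce X).Adj ⟨y, hy⟩ ⟨k, hKX hk⟩ := hyk
    have h2 := (hK.preconnected ⟨k, hk⟩ ⟨k₀, hk₀⟩).map (G.induceHomOfLE hKX).toHom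
    exact h1.reachable.trans h2
  set g : W → Set V := fun w => if v ∈ f w then f w ∪ K else f w with hg
  have hfg : ∀ w, f w ⊆ g w := by
    intro w
    simp only [hg]
    split
    · exact Set.subset_union_left
    · exact subset_rfl
  have hgf : ∀ w, g w ⊆ f w ∪ K := by
    intro w
    simp only [hg]
    split
    · exact subset_rfl
    · exact Set.subset_union_left
  have hgK : ∀ w, v ∈ f w → K ⊆ g w := by
    intro w hw
    simp only [hg, if_pos hw]
    exact Set.subset_union_right
  have hgK' : ∀ w x, x ∈ g w → x ∈ K → v ∈ f w := by
    intro w x hx hxK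
    by_contra hvw
    simp only [hg, if_neg hvw] at hx
    exact Set.disjoint_left.1 hKB hxK (hfB w hx)
  refine ⟨g, fun w => (hne w).mono (hfg w), fun w => ?_, fun w w' hww' => ?_, fun w w' hww' => ?_⟩
  · by_cases hw : v ∈ f w
    · rw [connected_iff_exists_forall_reachable]
      refine ⟨⟨k₀, hgK w hw hk₀⟩, fun ⟨y, hy⟩ => ?_⟩
      have hvk := hreach (g w) (hgK w hw) v (hfg w hw) ⟨k₀, hk₀, hvk₀⟩
      by_cases hyK : y ∈ K
      · exact (hK.preconnected ⟨k₀, hk₀⟩ ⟨y, hyK⟩).map (G.induceHomOfLE (hgK w hw)).toHom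
      · have hyf : y ∈ f w := (hgf w hy).resolve_right hyK
        have key : ∀ z : f w,
            Relation.ReflTransGen ((joinOn G B v T).induce (f w)).Adj ⟨v, hw⟩ z →
            (G.induce (g w)).Reachable ⟨k₀, hgK w hw hk₀⟩ ⟨z, hfg w z.2⟩ := by
          intro z hz
          induction hz with
          | refl => exact hvk.symm
          | @tail a b _ hab ih =>
            rcases hab.2.2.2 with h | ⟨-, h⟩ | ⟨h, -⟩
            · have h1 : (G.induce (g w)).Adj ⟨a, hfg w a.2⟩ ⟨b, hfg w b.2⟩ := h
              exact ih.trans h1.reachable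
            · exact (hreach (g w) (hgK w hw) b (hfg w b.2) (hT _ h)).symm
            · obtain rfl : (b : V) = v := h
              exact hvk.symm
        exact key ⟨y, hyf⟩ ((reachable_iff_reflTransGen _ _).1 ((hconn w).preconnected _ _))
    · have he : g w = f w := by simp only [hg, if_neg hw]
      rw [he]
      refine (hconn w).mono fun a b hab => ?_
      rcases hab.2.2.2 with h | ⟨h, -⟩ | ⟨h, -⟩
      · exact h
      · exact absurd (h ▸ a.2) hw
      · exact absurd (h ▸ b.2) hw
  · rw [Set.disjoint_left]
    intro x hx hx'
    have hd := Set.disjoint_left.1 (hdis w w' hww')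
    by_cases hxK : x ∈ K
    · exact hd (hgK' w x hx hxK) (hgK' w' x hx' hxK)
    · exact hd ((hgf w hx).resolve_right hxK) ((hgf w' hx').resolve_right hxK)
  · obtain ⟨a, ha, b, hb, hab⟩ := hadj w w' hww'
    rcases hab.2.2.2 with h | ⟨rfl, h⟩ | ⟨rfl, h⟩
    · exact ⟨a, hfg w ha, b, hfg w' hb, h⟩
    · obtain ⟨k, hk, hbk⟩ := hT b h
      exact ⟨k, hgK w ha hk, b, hfg w' hb, hbk.symm⟩
    · obtain ⟨k, hk, hak⟩ := hT a h
      exact ⟨a, hfg w ha, k, hgK w' hb hk, hak⟩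

theorem minorOf_succ_of_forall_adj {α : Type} {m : ℕ} {H : SimpleGraph α} {R : SimpleGraph V}
    {g : α → V} (hinj : Function.Injective g) (hadj : ∀ a b, H.Adj a b → R.Adj (g a) (g b))
    {x : V} (hx : ∀ a, R.Adj x (g a)) (h : (⊤ : SimpleGraph (Fin m)).MinorOf H) :
    (⊤ : SimpleGraph (Fin (m + 1))).MinorOf R := by
  obtain ⟨f, hne, hconn, hdis, hfadj⟩ := h
  have hxg : ∀ w, x ∉ g '' f w := by
    rintro w ⟨a, -, rfl⟩
    exact R.irrefl (hx a)
  have hxadj : ∀ w, ∃ b ∈ g '' f w, R.Adj x b := by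
    intro w
    obtain ⟨a, ha⟩ := hne w
    exact ⟨_, ⟨a, ha, rfl⟩, hx a⟩
  refine ⟨Fin.cons {x} fun w => g '' f w, ?_, ?_, ?_, ?_⟩
  · intro w
    refine Fin.cases ?_ (fun w => ?_) w
    · simp
    · simpa using hne w
  · intro w
    refine Fin.cases ?_ (fun w => ?_) w
    · exact connected_induce_singleton R x
    · change (R.induce (g '' f w)).Connected
      refine (hconn w).map (G := H.induce (f w)) (H := R.induce (g '' f w))
        ⟨fun a => ⟨g a, a.1, a.2, rfl⟩, fun {a b} hab => hadj a b hab⟩ ?_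
      rintro ⟨_, a, ha, rfl⟩
      exact ⟨⟨a, ha⟩, rfl⟩
  · intro w w'
    refine Fin.cases ?_ (fun w => ?_) w <;> refine Fin.cases ?_ (fun w' => ?_) w' <;> intro hww'
    · exact absurd rfl hww'
    · simpa using hxg w'
    · simpa using hxg w
    · simp only [Fin.cons_succ]
      exact (Set.disjoint_image_iff hinj).2 (hdis w w' fun h => hww' (h ▸ rfl))
  · intro w w'
    refine Fin.cases ?_ (fun w => ?_) w <;> refine Fin.cases ?_ (fun w' => ?_) w' <;> intro hww'
    · exact absurd rfl hww'
    · obtain ⟨b, hb, hxb⟩ := hxadj w'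
      exact ⟨x, by simp, b, by simpa using hb, hxb⟩
    · obtain ⟨b, hb, hxb⟩ := hxadj w
      exact ⟨b, by simpa using hb, x, by simp, hxb.symm⟩
    · obtain ⟨a, ha, b, hb, hab⟩ := hfadj w w' fun h => hww' (h ▸ rfl)
      exact ⟨g a, by simpa using ⟨a, ha, rfl⟩, g b, by simpa using ⟨b, hb, rfl⟩, hadj a b hab⟩

theorem minorOf_of_injective {m : ℕ} {G : SimpleGraph V} (f : Fin m → V)
    (hinj : Function.Injective f) (hadj : ∀ i j, i ≠ j → G.Adj (f i) (f j)) :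
    (⊤ : SimpleGraph (Fin m)).MinorOf G :=
  ⟨fun i => {f i}, fun _ => ⟨_, rfl⟩, fun i => connected_induce_singleton G (f i),
    fun i j hij => by simpa using fun h => hij (hinj h),
    fun i j hij => ⟨f i, rfl, f j, rfl, hadj i j hij⟩⟩

end Contraction

section Counting

variable {V : Type}

open scoped Classical in
/-- The number of pairs in `A × B` related by `r`. -/
noncomputable def pairCount (r : V → V → Prop) (A B : Finset V) : ℕ :=
  ∑ a ∈ A, ∑ b ∈ B, if r a b then 1 else 0

theorem pairCount_singleton (r : V → V → Prop) (v : V) (B : Finset V) [DecidablePred (r v)] :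
    pairCount r {v} B = (B.filter (r v)).card := by
  rw [pairCount, Finset.sum_singleton, Finset.card_filter]
  exact Finset.sum_congr rfl fun b _ => by congr

theorem pairCount_eq_sum (r : V → V → Prop) (A B : Finset V) :
    pairCount r A B = ∑ a ∈ A, pairCount r {a} B := by
  simp [pairCount]

theorem pairCount_union_left [DecidableEq V] (r : V → V → Prop) {A A' : Finset V} (B : Finset V)
    (h : Disjoint A A') : pairCount r (A ∪ A') B = pairCount r A B + pairCount r A' B :=
  Finset.sum_union h

theorem pairCount_union_right [DecidableEq V] (r : V → V → Prop) (A : Finset V) {B B' : Finset V}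
    (h : Disjoint B B') : pairCount r A (B ∪ B') = pairCount r A B + pairCount r A B' := by
  simp only [pairCount, Finset.sum_union h, Finset.sum_add_distrib]

theorem pairCount_comm (G : SimpleGraph V) (A B : Finset V) :
    pairCount G.Adj A B = pairCount G.Adj B A := by
  classical
  rw [pairCount, pairCount, Finset.sum_comm]
  exact Finset.sum_congr rfl fun b _ => Finset.sum_congr rfl fun a _ =>
    if_congr (G.adj_comm a b) rfl rfl

theorem pairCount_eq_zero {r : V → V → Prop} {A B : Finset V} (h : ∀ a ∈ A, ∀ b ∈ B, ¬ r a b) :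
    pairCount r A B = 0 :=
  Finset.sum_eq_zero fun a ha => Finset.sum_eq_zero fun b hb => if_neg (h a ha b hb)

theorem pairCount_le_mul_left {r : V → V → Prop} {A B : Finset V} {c : ℕ}
    (h : ∀ a ∈ A, pairCount r {a} B ≤ c) : pairCount r A B ≤ A.card * c := by
  rw [pairCount_eq_sum, ← smul_eq_mul]
  exact Finset.sum_le_card_nsmul _ _ _ h

theorem mul_le_pairCount {r : V → V → Prop} {A B : Finset V} {c : ℕ}
    (h : ∀ a ∈ A, c ≤ pairCount r {a} B) : A.card * c ≤ pairCount r A B := by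
  rw [pairCount_eq_sum, ← smul_eq_mul]
  exact Finset.card_nsmul_le_sum _ _ _ h

/-- Twice the number of edges of `G` inside `A`. -/
noncomputable def edgeCount (G : SimpleGraph V) (A : Finset V) : ℕ := pairCount G.Adj A A

theorem edgeCount_union [DecidableEq V] (G : SimpleGraph V) {A B : Finset V} (h : Disjoint A B) :
    edgeCount G (A ∪ B) = edgeCount G A + edgeCount G B + 2 * pairCount G.Adj A B := by
  have := pairCount_comm G A B
  simp only [edgeCount, pairCount_union_left _ _ h, pairCount_union_right _ _ h]
  omega

theorem pairCount_erase [DecidableEq V] (G : SimpleGraph V) (A : Finset V) (v : V) :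
    pairCount G.Adj {v} (A.erase v) = pairCount G.Adj {v} A := by
  classical
  rw [pairCount_singleton, pairCount_singleton]
  congr 1
  ext w
  simp only [Finset.mem_filter, Finset.mem_erase]
  exact ⟨fun h => ⟨h.1.2, h.2⟩, fun h => ⟨⟨fun he => G.irrefl (he ▸ h.2), h.1⟩, h.2⟩⟩

theorem edgeCount_erase [DecidableEq V] (G : SimpleGraph V) {A : Finset V} {v : V} (hv : v ∈ A) :
    edgeCount G A = edgeCount G (A.erase v) + 2 * pairCount G.Adj {v} A := by
  have h1 : edgeCount G {v} = 0 := pairCount_eq_zero fun a ha b hb => by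
    rw [Finset.mem_singleton.1 ha, Finset.mem_singleton.1 hb]
    exact G.irrefl
  have h2 := edgeCount_union G (A := {v}) (B := A.erase v)
    (Finset.disjoint_singleton_left.2 (Finset.notMem_erase v A))
  rw [← Finset.insert_eq, Finset.insert_erase hv, pairCount_erase, h1] at h2
  omega

theorem pairCount_lt_card (G : SimpleGraph V) {A : Finset V} {v : V} (hv : v ∈ A) :
    pairCount G.Adj {v} A + 1 ≤ A.card := by
  classical
  rw [pairCount_singleton]
  exact Finset.card_lt_card (Finset.filter_ssubset.2 ⟨v, hv, G.irrefl⟩)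

theorem edgeCount_le (G : SimpleGraph V) (A : Finset V) :
    edgeCount G A ≤ A.card * (A.card - 1) :=
  pairCount_le_mul_left fun a ha => by
    have := pairCount_lt_card G ha
    omega

/-- The relation of being distinct and not adjacent. -/
def Apart (G : SimpleGraph V) (a b : V) : Prop := b ≠ a ∧ ¬ G.Adj a b

theorem pairCount_add_apart (G : SimpleGraph V) {A : Finset V} {v : V} (hv : v ∈ A) :
    pairCount G.Adj {v} A + pairCount (Apart G) {v} A + 1 = A.card := by
  classical
  have h1 : (A.filter (G.Adj v)).card + (A.filter fun b => ¬ G.Adj v b).card = A.card :=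
    Finset.card_filter_add_card_filter_not _
  have h2 : (A.filter fun b => ¬ G.Adj v b) = insert v (A.filter (Apart G v)) := by
    ext b
    simp only [Finset.mem_filter, Finset.mem_insert, Apart]
    by_cases hb : b = v
    · subst hb
      simpa using hv
    · simp [hb]
  rw [h2, Finset.card_insert_of_notMem (by simp [Apart])] at h1
  rw [pairCount_singleton, pairCount_singleton]
  omega

theorem edgeCount_add_apart (G : SimpleGraph V) (A : Finset V) :
    edgeCount G A + pairCount (Apart G) A A = A.card * (A.card - 1) := by
  rw [edgeCount, pairCount_eq_sum, pairCount_eq_sum (Apart G), ← Finset.sum_add_distrib,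
    ← smul_eq_mul, ← Finset.sum_const]
  refine Finset.sum_congr rfl fun a ha => ?_
  have := pairCount_add_apart G ha
  omega

theorem edgeCount_joinOn (G : SimpleGraph V) {B : Finset V} {v : V} (hv : v ∈ B) {T : Set V}
    {W : Finset V} (hW : ∀ w ∈ W, w ∈ B ∧ w ∈ T ∧ Apart G v w) :
    edgeCount G B + 2 * W.card ≤ edgeCount (joinOn G B v T) B := by
  classical
  have h1 : ∑ a ∈ B, ∑ b ∈ B, (if a = v ∧ b ∈ W then 1 else 0) = W.card := by
    have hBW : B.filter (· ∈ W) = W := by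
      ext w
      simp only [Finset.mem_filter, and_iff_right_iff_imp]
      exact fun h => (hW w h).1
    rw [Finset.sum_eq_single_of_mem v hv fun a _ hav => Finset.sum_eq_zero fun b _ => by
      simp [hav]]
    simp only [true_and]
    rw [← Finset.card_filter, hBW]
  have h2 : ∑ a ∈ B, ∑ b ∈ B, (if b = v ∧ a ∈ W then 1 else 0) = W.card := by
    rw [Finset.sum_comm]
    exact h1
  have h3 : edgeCount G B + 2 * W.card = ∑ a ∈ B, ∑ b ∈ B,
      ((if G.Adj a b then 1 else 0) + ((if a = v ∧ b ∈ W then 1 else 0) +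
        if b = v ∧ a ∈ W then 1 else 0)) := by
    simp only [Finset.sum_add_distrib, h1, h2, edgeCount, pairCount, two_mul]
  rw [h3, edgeCount, pairCount]
  refine Finset.sum_le_sum fun a ha => Finset.sum_le_sum fun b hb => ?_
  have key : ∀ a ∈ B, ∀ b ∈ B, a = v → b ∈ W → ¬ G.Adj a b ∧ (joinOn G B v T).Adj a b ∧ b ≠ v := by
    rintro a ha b hb rfl hbW
    obtain ⟨-, h1, h2, h3⟩ := hW b hbW
    exact ⟨h3, ⟨h2.symm, ha, hb, Or.inr (Or.inl ⟨rfl, h1⟩)⟩, h2⟩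
  by_cases hab : a = v ∧ b ∈ W
  · obtain ⟨h4, h5, h6⟩ := key a ha b hb hab.1 hab.2
    rw [if_neg h4, if_pos hab, if_neg fun h => h6 h.1, if_pos h5]
  · by_cases hba : b = v ∧ a ∈ W
    · obtain ⟨h4, h5, h6⟩ := key b hb a ha hba.1 hba.2
      rw [if_neg fun h => h4 h.symm, if_neg hab, if_pos hba, if_pos h5.symm]
    · by_cases hG : G.Adj a b
      · have : (joinOn G B v T).Adj a b := ⟨hG.ne, ha, hb, Or.inl hG⟩
        simp [hab, hba, this, hG]
      · simp [hab, hba, hG]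

theorem exists_connected_component (G : SimpleGraph V) {R : Finset V} {y : V} (hy : y ∈ R) :
    ∃ K ⊆ R, y ∈ K ∧ (G.induce (K : Set V)).Connected ∧ ∀ a ∈ K, ∀ b ∈ R, G.Adj a b → b ∈ K := by
  classical
  obtain ⟨K, hK, hmax⟩ := Finset.exists_max_image
    (R.powerset.filter fun K : Finset V => y ∈ K ∧ (G.induce (K : Set V)).Connected) Finset.card
    ⟨{y}, by
      simp only [Finset.mem_filter, Finset.mem_powerset, Finset.singleton_subset_iff,
        Finset.mem_singleton, true_and]
      rw [Finset.coe_singleton]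
      exact ⟨hy, connected_induce_singleton G y⟩⟩
  simp only [Finset.mem_filter, Finset.mem_powerset] at hK hmax
  refine ⟨K, hK.1, hK.2.1, hK.2.2, fun a ha b hb hab => ?_⟩
  by_contra hbK
  have h1 := hmax (insert b K) ⟨Finset.insert_subset hb hK.1, Finset.mem_insert_of_mem hK.2.1, by
    rw [Finset.coe_insert, Set.insert_eq]
    exact connected_induce_union (connected_induce_singleton G b).preconnected
      hK.2.2.preconnected rfl ha hab.symm⟩
  rw [Finset.card_insert_of_notMem hbK] at h1
  omega

theorem exists_minorOf_joinOn {G : SimpleGraph V} {N S : Finset V} (hSN : S ⊆ N)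
    (h6 : 6 ≤ N.card) (h9 : N.card ≤ 9) (hN : ∀ v ∈ N, 5 ≤ pairCount G.Adj {v} N)
    (hS : S.Nonempty)
    (hJ : ∀ v ∈ S, 4 * pairCount (Apart G) {v} S + 1 ≤ pairCount (Apart G) S S) :
    ∃ p ∈ S, (⊤ : SimpleGraph (Fin 6)).MinorOf
      ((joinOn G N p S).comap (Subtype.val : {y // y ∈ N} → V)) := by
  classical
  set H : SimpleGraph {y // y ∈ N} := G.comap Subtype.val with hH
  have hadj : ∀ a b : {y // y ∈ N}, Hᶜ.Adj a b ↔ Apart G a b := by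
    intro a b
    rw [compl_adj, Apart, hH, comap_adj, ne_comm, Ne, Subtype.ext_iff]
  have hcard : ∀ (X : Finset V), X ⊆ N → ∀ v : {y // y ∈ N},
      ((X.subtype (· ∈ N)).filter (Hᶜ.Adj v)).card = pairCount (Apart G) {(v : V)} X := by
    intro X hX v
    rw [pairCount_singleton]
    refine Finset.card_bij (fun a _ => a) ?_ ?_ ?_
    · intro a ha
      simpa [hadj] using ha
    · intro a _ b _ hab
      exact Subtype.ext hab
    · intro b hb
      rw [Finset.mem_filter] at hb
      exact ⟨⟨b, hX hb.1⟩, by simpa [hadj] using hb, rfl⟩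
  have hsum : ∑ v ∈ S.subtype (· ∈ N), ((S.subtype (· ∈ N)).filter (Hᶜ.Adj v)).card =
      pairCount (Apart G) S S := by
    rw [pairCount_eq_sum, ← Finset.sum_subtype_of_mem _ fun x hx => hSN hx]
    exact Finset.sum_congr rfl fun v _ => hcard S hSN v
  have hle : ∀ p ∈ S, H ≤ (joinOn G N p S).comap Subtype.val :=
    fun p hp a b hab => ⟨fun he => hab.ne (Subtype.ext he), a.2, b.2, Or.inl hab⟩
  have hmain := minorOf_compl_or_edge Hᶜ (S := S.subtype (· ∈ N)) (by simpa using h6)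
    (by simpa using h9) (fun v => by
      have h1 := hcard N subset_rfl v
      have h2 := pairCount_add_apart G v.2
      have h3 := hN v v.2
      have h4 : N.subtype (· ∈ N) = Finset.univ := by
        ext a
        simp
      rw [h4] at h1
      rw [ncard_neighborSet_eq_degree, ← card_neighborFinset_eq_degree,
        neighborFinset_eq_filter, h1, Fintype.card_coe]
      omega) (by
      obtain ⟨v, hv⟩ := hS
      exact ⟨⟨v, hSN hv⟩, by simpa using hv⟩) (fun v hv => by
      rw [hsum, hcard S hSN]
      exact hJ v (by simpa using hv))
  rw [compl_compl] at hmain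
  rcases hmain with h | ⟨p, hp, q, hq, hpq, h⟩
  · obtain ⟨p, hp⟩ := hS
    exact ⟨p, hp, minorOf_mono (hle p hp) h⟩
  · rw [Finset.mem_subtype] at hp hq
    refine ⟨p, hp, minorOf_mono (sup_le (hle p hp) fun a b hab => ?_) h⟩
    rw [edge_adj] at hab
    refine ⟨fun he => hab.2 (Subtype.ext he), a.2, b.2, Or.inr ?_⟩
    rcases hab.1 with ⟨rfl, rfl⟩ | ⟨rfl, rfl⟩
    · exact Or.inl ⟨rfl, hq⟩
    · exact Or.inr ⟨rfl, hq⟩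

end Counting

section EdgeBound

variable {V : Type} {G : SimpleGraph V} {A : Finset V}

/-- Every `K₇`-minor free graph satisfies the edge bound on all sets with `m` vertices, where
`5 ≤ m < n`. -/
def EdgeBoundBelow (V : Type) (n : ℕ) : Prop :=
  ∀ (G : SimpleGraph V) (A : Finset V), ¬ (⊤ : SimpleGraph (Fin 7)).MinorOf G → 5 ≤ A.card →
    A.card < n → edgeCount G A + 30 ≤ 10 * A.card

theorem EdgeBoundBelow.five_le_common (ih : EdgeBoundBelow V A.card) [DecidableRel G.Adj]
    (hfree : ¬ (⊤ : SimpleGraph (Fin 7)).MinorOf G) (h7 : 7 ≤ A.card)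
    (hbig : 10 * A.card < edgeCount G A + 30) {u v : V} (hu : u ∈ A.filter (G.Adj v))
    (hv : v ∈ A) : 5 ≤ pairCount G.Adj {u} (A.filter (G.Adj v)) := by
  classical
  obtain ⟨huA, hvu⟩ := Finset.mem_filter.1 hu
  have hcard := Finset.card_erase_of_mem hv
  have huB : u ∈ A.erase v := Finset.mem_erase.2 ⟨hvu.ne', huA⟩
  have h1 := ih (joinOn G (A.erase v : Finset V) u (G.neighborSet v)) (A.erase v) (fun h =>
    hfree (minorOf_of_minorOf_joinOn (connected_induce_singleton G v) (by simp)
      ⟨v, rfl, hvu.symm⟩ (fun t ht => ⟨v, rfl, (show G.Adj v t from ht).symm⟩) h))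
    (by omega) (by omega)
  have h2 := edgeCount_joinOn G huB (T := G.neighborSet v)
    (W := (A.filter (G.Adj v)).filter (Apart G u)) (fun w hw => by
      simp only [Finset.mem_filter] at hw
      exact ⟨Finset.mem_erase.2 ⟨hw.1.2.ne', hw.1.1⟩, hw.1.2, hw.2⟩)
  have h3 := pairCount_add_apart G hu
  have h4 := edgeCount_erase G hv
  rw [pairCount_singleton (Apart G)] at h3
  rw [pairCount_singleton] at h4
  omega

theorem EdgeBoundBelow.six_le_degree (ih : EdgeBoundBelow V A.card)
    (hfree : ¬ (⊤ : SimpleGraph (Fin 7)).MinorOf G) (h7 : 7 ≤ A.card)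
    (hbig : 10 * A.card < edgeCount G A + 30) {v : V} (hv : v ∈ A) :
    6 ≤ pairCount G.Adj {v} A := by
  classical
  have hcard := Finset.card_erase_of_mem hv
  have h1 := ih G (A.erase v) hfree (by omega) (by omega)
  have h2 := edgeCount_erase G hv
  omega

theorem minorOf_of_isClique {m : ℕ} (hm : m ≤ A.card) (hA : G.IsClique (A : Set V)) :
    (⊤ : SimpleGraph (Fin m)).MinorOf G := by
  obtain ⟨B, hBA, hB⟩ := Finset.exists_subset_card_eq hm
  let e := (Finset.equivFinOfCardEq hB).symm
  refine minorOf_of_injective (fun i => (e i : V))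
    (Subtype.val_injective.comp e.injective) fun i j hij => ?_
  exact hA (hBA (e i).2) (hBA (e j).2) fun h => hij (e.injective (Subtype.ext h))

theorem edgeCount_separation [DecidableEq V] {K S P : Finset V} (hKS : Disjoint K S)
    (hKP : Disjoint K P) (hSP : Disjoint S P) (h : ∀ a ∈ K, ∀ b ∈ P, ¬ G.Adj a b) :
    edgeCount G (S ∪ P) + edgeCount G (K ∪ S) =
      edgeCount G (K ∪ (S ∪ P)) + edgeCount G S := by
  rw [edgeCount_union G hSP, edgeCount_union G hKS,
    edgeCount_union G (Finset.disjoint_union_right.2 ⟨hKS, hKP⟩), edgeCount_union G hSP,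
    pairCount_union_right _ _ hSP, pairCount_eq_zero h]
  omega

theorem four_mul_lt_of_edgeCount {S : Finset V} {m : ℕ}
    (h : edgeCount G S + 4 * m + 31 ≤ 10 * S.card) :
    4 * m + 1 ≤ pairCount (Apart G) S S := by
  have h1 := edgeCount_add_apart G S
  obtain ⟨s, hs⟩ : ∃ s, S.card = s := ⟨_, rfl⟩
  rw [hs] at h h1
  rcases Nat.lt_or_ge s 6 with hlt | hge
  · interval_cases s <;> omega
  · obtain ⟨t, rfl⟩ := Nat.exists_eq_add_of_le hge
    have h2 : (6 + t) * (6 + t - 1) = t * t + 11 * t + 30 := by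
      rw [show 6 + t - 1 = t + 5 by omega]
      ring
    have h3 : t ≤ t * t := Nat.le_mul_self t
    omega

theorem EdgeBoundBelow.edgeCount_le_of_degree_le (ih : EdgeBoundBelow V A.card)
    (hfree : ¬ (⊤ : SimpleGraph (Fin 7)).MinorOf G) (h7 : 7 ≤ A.card) {x : V} (hx : x ∈ A)
    (hmin : ∀ v ∈ A, pairCount G.Adj {x} A ≤ pairCount G.Adj {v} A)
    (h9 : pairCount G.Adj {x} A ≤ 9) : edgeCount G A + 30 ≤ 10 * A.card := by
  classical
  by_contra! hbig
  set N := A.filter (G.Adj x) with hNdef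
  have hNA : N ⊆ A := Finset.filter_subset _ _
  have hxN : x ∉ N := by simp [hNdef]
  have hNadj : ∀ v ∈ N, G.Adj x v := fun v hv => (Finset.mem_filter.1 hv).2
  have hNcard : N.card = pairCount G.Adj {x} A := (pairCount_singleton G.Adj x A).symm
  have h6 := ih.six_le_degree hfree h7 hbig hx
  have hN5 : ∀ v ∈ N, 5 ≤ pairCount G.Adj {v} N := fun v hv =>
    ih.five_le_common hfree h7 hbig hv hx
  obtain ⟨y, hy⟩ : (A.filter (Apart G x)).Nonempty := by
    by_contra! hempty
    refine hfree (minorOf_of_isClique h7 fun a ha b hb hab => ?_)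
    have hdeg : ∀ v ∈ A, pairCount (Apart G) {v} A = 0 := by
      intro v hv
      have h1 := pairCount_add_apart G hx
      have h2 := pairCount_add_apart G hv
      have h3 := hmin v hv
      rw [pairCount_singleton (Apart G)] at h1
      have h4 : (A.filter (Apart G x)).card = 0 := Finset.card_eq_zero.2 hempty
      omega
    have h1 := hdeg a ha
    rw [pairCount_singleton, Finset.card_eq_zero, Finset.filter_eq_empty_iff] at h1
    by_contra hnab
    exact h1 hb ⟨hab.symm, hnab⟩
  obtain ⟨K, hKR, hyK, hKconn, hKmax⟩ := exists_connected_component G hy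
  have hKA : K ⊆ A := fun k hk => (Finset.mem_filter.1 (hKR hk)).1
  have hKx : ∀ k ∈ K, k ≠ x ∧ ¬ G.Adj x k := fun k hk => (Finset.mem_filter.1 (hKR hk)).2
  set S := N.filter (fun v => ∃ k ∈ K, G.Adj v k) with hSdef
  have hSN : S ⊆ N := Finset.filter_subset _ _
  have hSK : ∀ v ∈ S, ∃ k ∈ K, G.Adj v k := fun v hv => (Finset.mem_filter.1 hv).2
  set P := A \ (K ∪ S) with hPdef
  have hKN : Disjoint K N := Finset.disjoint_left.2 fun k hk hkN => (hKx k hk).2 (hNadj k hkN)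
  have hKS : Disjoint K S := Finset.disjoint_of_subset_right hSN hKN
  have hKP : Disjoint K P := Finset.disjoint_left.2 fun k hk hkP =>
    (Finset.mem_sdiff.1 hkP).2 (Finset.mem_union_left _ hk)
  have hSP : Disjoint S P := Finset.disjoint_left.2 fun k hk hkP =>
    (Finset.mem_sdiff.1 hkP).2 (Finset.mem_union_right _ hk)
  have hKSP : Disjoint K (S ∪ P) := Finset.disjoint_union_right.2 ⟨hKS, hKP⟩
  have hnoKP : ∀ a ∈ K, ∀ b ∈ P, ¬ G.Adj a b := by
    intro a ha b hb hab
    obtain ⟨hbA, hbKS⟩ := Finset.mem_sdiff.1 hb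
    rw [Finset.mem_union, not_or] at hbKS
    by_cases hbN : b ∈ N
    · exact hbKS.2 (Finset.mem_filter.2 ⟨hbN, a, ha, hab.symm⟩)
    · refine hbKS.1 (hKmax a ha b (Finset.mem_filter.2 ⟨hbA, ?_, fun h => ?_⟩) hab)
      · rintro rfl
        exact (hKx a ha).2 hab.symm
      · exact hbN (Finset.mem_filter.2 ⟨hbA, h⟩)
  have hA : K ∪ (S ∪ P) = A := by
    rw [← Finset.union_assoc, hPdef]
    exact Finset.union_sdiff_of_subset (Finset.union_subset hKA (hSN.trans hNA))
  have hsep := edgeCount_separation hKS hKP hSP hnoKP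
  rw [hA] at hsep
  have hcardA : K.card + (S ∪ P).card = A.card := by rw [← Finset.card_union_of_disjoint hKSP, hA]
  have hcardKS : (K ∪ S).card = K.card + S.card := Finset.card_union_of_disjoint hKS
  have hcardSP : (S ∪ P).card = S.card + P.card := Finset.card_union_of_disjoint hSP
  have hKpos : 0 < K.card := Finset.card_pos.2 ⟨y, hyK⟩
  have hxSP : x ∈ S ∪ P := by
    have : x ∈ K ∪ (S ∪ P) := hA ▸ hx
    exact (Finset.mem_union.1 this).resolve_left fun h => (hKx x h).1 rfl
  have hxKS : x ∉ K ∪ S := by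
    rw [Finset.mem_union]
    rintro (h | h)
    · exact (hKx x h).1 rfl
    · exact hxN (hSN h)
  have hxP : x ∈ P := Finset.mem_sdiff.2 ⟨hx, hxKS⟩
  have hPpos : 0 < P.card := Finset.card_pos.2 ⟨x, hxP⟩
  have hNSP : N ⊆ S ∪ P := by
    intro v hv
    have : v ∈ K ∪ (S ∪ P) := hA ▸ hNA hv
    exact (Finset.mem_union.1 this).resolve_left fun h => Finset.disjoint_left.1 hKN h hv
  have hSPge : 7 ≤ (S ∪ P).card := by
    have := Finset.card_le_card (Finset.insert_subset hxSP hNSP)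
    rw [Finset.card_insert_of_notMem hxN] at this
    omega
  have hKSge : 7 ≤ (K ∪ S).card := by
    have h1 := ih.six_le_degree hfree h7 hbig (hKA hyK)
    rw [pairCount_singleton] at h1
    have h2 : insert y (A.filter (G.Adj y)) ⊆ K ∪ S := by
      refine Finset.insert_subset (Finset.mem_union_left _ hyK) fun z hz => ?_
      obtain ⟨hzA, hyz⟩ := Finset.mem_filter.1 hz
      by_contra hzKS
      exact hnoKP y hyK z (Finset.mem_sdiff.2 ⟨hzA, hzKS⟩) hyz
    have h3 := Finset.card_le_card h2
    rw [Finset.card_insert_of_notMem (by simp)] at h3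
    omega
  rcases S.eq_empty_or_nonempty with hS | hS
  · have h1 := ih G (S ∪ P) hfree (by omega) (by omega)
    have h2 := ih G (K ∪ S) hfree (by omega) (by omega)
    have h3 : S.card = 0 := Finset.card_eq_zero.2 hS
    omega
  · have hJ : ∀ v ∈ S, 4 * pairCount (Apart G) {v} S + 1 ≤ pairCount (Apart G) S S := by
      intro v hv
      apply four_mul_lt_of_edgeCount
      have hW : ∀ B : Finset V, S ⊆ B → ∀ w ∈ S.filter (Apart G v),
          w ∈ B ∧ w ∈ (S : Set V) ∧ Apart G v w := fun B hB w hw =>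
        ⟨hB (Finset.mem_filter.1 hw).1, (Finset.mem_filter.1 hw).1, (Finset.mem_filter.1 hw).2⟩
      have h1 := ih (joinOn G (S ∪ P : Finset V) v S) (S ∪ P) (fun h =>
        hfree (minorOf_of_minorOf_joinOn hKconn (Finset.disjoint_coe.2 hKSP) (hSK v hv)
          (fun t ht => hSK t ht) h)) (by omega) (by omega)
      have h2 := edgeCount_joinOn G (Finset.mem_union_left P hv)
        (hW (S ∪ P) Finset.subset_union_left)
      have h3 := ih (joinOn G (K ∪ S : Finset V) v S) (K ∪ S) (fun h =>
        hfree (minorOf_of_minorOf_joinOn (connected_induce_singleton G x)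
          (Set.disjoint_singleton_left.2 hxKS)
          ⟨x, rfl, (hNadj v (hSN hv)).symm⟩
          (fun t ht => ⟨x, rfl, (hNadj t (hSN ht)).symm⟩) h)) (by omega) (by omega)
      have h4 := edgeCount_joinOn G (Finset.mem_union_right K hv)
        (hW (K ∪ S) Finset.subset_union_right)
      rw [pairCount_singleton]
      omega
    obtain ⟨p, hp, hminor⟩ := exists_minorOf_joinOn hSN (by omega) (by omega) hN5 hS hJ
    refine hfree (minorOf_of_minorOf_joinOn (B := insert x (N : Set V)) (T := S) hKconn ?_
      (hSK p hp) (fun t ht => hSK t ht)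
      (minorOf_succ_of_forall_adj Subtype.val_injective (x := x) ?_ ?_ hminor))
    · rw [Set.disjoint_insert_right, Finset.disjoint_coe]
      exact ⟨fun h => (hKx x h).1 rfl, hKN⟩
    · rintro a b ⟨h1, h2, h3, h4⟩
      exact ⟨h1, Or.inr h2, Or.inr h3, h4⟩
    · intro a
      have := hNadj a a.2
      exact ⟨this.ne, Or.inl rfl, Or.inr a.2, Or.inl this⟩

theorem edgeCount_le_add_two {H : SimpleGraph V} {a b : V}
    (h : ∀ c d, G.Adj c d → H.Adj c d ∨ (c = a ∧ d = b) ∨ (c = b ∧ d = a)) :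
    edgeCount G A ≤ edgeCount H A + 2 := by
  classical
  have hle : ∀ v w : V, (∑ c ∈ A, ∑ d ∈ A, if c = v ∧ d = w then 1 else 0) ≤ 1 := by
    intro v w
    rw [← Finset.sum_product', ← Finset.card_filter, Finset.card_le_one]
    simp only [Finset.mem_filter]
    rintro ⟨c, d⟩ ⟨-, rfl, rfl⟩ ⟨c', d'⟩ ⟨-, h1, h2⟩
    exact Prod.ext h1.symm h2.symm
  have h1 := hle a b
  have h2 := hle b a
  have h3 : edgeCount G A ≤ ∑ c ∈ A, ∑ d ∈ A, ((if H.Adj c d then 1 else 0) +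
      ((if c = a ∧ d = b then 1 else 0) + if c = b ∧ d = a then 1 else 0)) := by
    rw [edgeCount, pairCount]
    refine Finset.sum_le_sum fun c _ => Finset.sum_le_sum fun d _ => ?_
    have hcd := h c d
    split_ifs <;> first | omega | tauto
  have h4 : edgeCount H A = ∑ c ∈ A, ∑ d ∈ A, if H.Adj c d then 1 else 0 := rfl
  simp only [Finset.sum_add_distrib] at h3
  omega

theorem edgeCount_lt_of_le {H : SimpleGraph V} (hle : H ≤ G) {a b : V} (ha : a ∈ A) (hb : b ∈ A)
    (hab : G.Adj a b) (hnab : ¬ H.Adj a b) : edgeCount H A < edgeCount G A := by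
  classical
  have hle' : ∀ c d, (if H.Adj c d then 1 else 0) ≤ if G.Adj c d then 1 else 0 := by
    intro c d
    have := @hle c d
    split_ifs <;> first | omega | tauto
  refine Finset.sum_lt_sum (fun c _ => Finset.sum_le_sum fun d _ => hle' c d) ⟨a, ha, ?_⟩
  refine Finset.sum_lt_sum (fun d _ => hle' a d) ⟨b, hb, ?_⟩
  rw [if_pos hab, if_neg hnab]
  exact Nat.zero_lt_one

/-- Mader's edge bound for `K₇`-minor free graphs, restricted to a set of vertices. -/
theorem edgeCount_add_le (hfree : ¬ (⊤ : SimpleGraph (Fin 7)).MinorOf G) (h5 : 5 ≤ A.card) :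
    edgeCount G A + 30 ≤ 10 * A.card := by
  classical
  obtain ⟨n, hn⟩ : ∃ n, A.card = n := ⟨_, rfl⟩
  induction n using Nat.strong_induction_on generalizing G A with
  | _ n ihn =>
    have ih : EdgeBoundBelow V A.card := fun G' B hG' h5' hlt =>
      ihn B.card (hn ▸ hlt) hG' h5' rfl
    obtain ⟨e, he⟩ : ∃ e, edgeCount G A = e := ⟨_, rfl⟩
    induction e using Nat.strong_induction_on generalizing G with
    | _ e ihe =>
      by_contra! hbig
      have h7 : 7 ≤ A.card := by
        have h1 := edgeCount_le G A
        by_contra! hlt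
        rw [hn] at h1 hbig hlt h5
        interval_cases n <;> omega
      obtain ⟨a, ha, b, hb, hab⟩ : ∃ a ∈ A, ∃ b ∈ A, G.Adj a b := by
        by_contra! hcon
        have : edgeCount G A = 0 := pairCount_eq_zero hcon
        omega
      have h1 := ihe _ (he ▸ edgeCount_lt_of_le (deleteEdges_le {s(a, b)}) ha hb hab
          (by simp [deleteEdges_adj]))
        (fun h => hfree (minorOf_mono (deleteEdges_le _) h)) rfl
      have h2 := edgeCount_le_add_two (G := G) (A := A) (H := G.deleteEdges {s(a, b)}) (a := a)
        (b := b) fun c d hcd => by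
          rw [deleteEdges_adj, Set.mem_singleton_iff, Sym2.eq_iff]
          tauto
      obtain ⟨x, hx, hmin⟩ := Finset.exists_min_image A (fun v => pairCount G.Adj {v} A) ⟨a, ha⟩
      have h3 : A.card * pairCount G.Adj {x} A ≤ edgeCount G A := mul_le_pairCount hmin
      have h9 : pairCount G.Adj {x} A ≤ 9 := by
        by_contra! hlt
        have h4 : A.card * 10 ≤ A.card * pairCount G.Adj {x} A := Nat.mul_le_mul_left _ hlt
        omega
      have := ih.edgeCount_le_of_degree_le hfree h7 hx hmin h9
      omega

end EdgeBound

theorem card_inter_neighborFinset {V : Type} [Fintype V] (G : SimpleGraph V) [DecidableRel G.Adj]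
    (u v : V) : pairCount G.Adj {v} (G.neighborFinset u) =
      (G.neighborSet u ∩ G.neighborSet v).ncard := by
  rw [pairCount_singleton, ← Set.ncard_coe_finset]
  congr 1
  ext w
  simp

/-- Let `G` be a finite simple graph with at least one edge, no `K_7`-minor,
such that every edge incident to a vertex of degree at most 9 belongs to at
least 5 triangles.  Then for every vertex `u` of degree at most 9 and every
connected component `C` of the induced subgraph `G \ N[u]`, some vertex of `C`
has degree at most 9 in `G`. -/
theorem statement17 {V : Type} [Fintype V] (G : SimpleGraph V) [DecidableRel G.Adj]
    (hedge : G.edgeSet.Nonempty)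
    (hfree : ¬ (⊤ : SimpleGraph (Fin 7)).MinorOf G)
    (htri : ∀ u v : V, G.Adj u v → G.degree u ≤ 9 →
      5 ≤ (G.neighborSet u ∩ G.neighborSet v).ncard) :
    ∀ u : V, G.degree u ≤ 9 →
      ∀ C : (G.induce ((insert u (G.neighborSet u))ᶜ : Set V)).ConnectedComponent,
        ∃ v : ((insert u (G.neighborSet u))ᶜ : Set V),
          (G.induce ((insert u (G.neighborSet u))ᶜ : Set V)).connectedComponentMk v = C ∧
          G.degree (v : V) ≤ 9 := by
  classical
  intro u hu C
  by_contra! hcon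
  set N := G.neighborFinset u with hN
  set K : Finset V := Finset.univ.filter fun v =>
    ∃ h : v ∈ ((insert u (G.neighborSet u))ᶜ : Set V),
      (G.induce ((insert u (G.neighborSet u))ᶜ : Set V)).connectedComponentMk ⟨v, h⟩ = C with hK
  have hmemK : ∀ v, v ∈ K ↔ ∃ h : v ∈ ((insert u (G.neighborSet u))ᶜ : Set V),
      (G.induce ((insert u (G.neighborSet u))ᶜ : Set V)).connectedComponentMk ⟨v, h⟩ = C := by
    simp [hK]
  have hKout : ∀ v ∈ K, v ≠ u ∧ ¬ G.Adj u v := by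
    intro v hv
    obtain ⟨h, -⟩ := (hmemK v).1 hv
    simpa using h
  have huN : u ∉ N := by simp [hN]
  have huK : u ∉ K := fun h => (hKout u h).1 rfl
  have hKN : Disjoint K N := Finset.disjoint_left.2 fun v hv hvN =>
    (hKout v hv).2 (by simpa [hN] using hvN)
  have hdeg : ∀ v ∈ K, 10 ≤ G.degree v := by
    intro v hv
    obtain ⟨h, hC⟩ := (hmemK v).1 hv
    exact hcon ⟨v, h⟩ hC
  have hnbr : ∀ v ∈ K, ∀ w, G.Adj v w → w ∈ K ∪ N := by
    intro v hv w hvw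
    obtain ⟨h, hC⟩ := (hmemK v).1 hv
    rw [Finset.mem_union]
    by_cases hw : w ∈ N
    · exact Or.inr hw
    · have hw' : w ∈ ((insert u (G.neighborSet u))ᶜ : Set V) := by
        simp only [Set.mem_compl_iff, Set.mem_insert_iff, mem_neighborSet, not_or]
        refine ⟨?_, by simpa [hN] using hw⟩
        rintro rfl
        exact (hKout v hv).2 hvw.symm
      refine Or.inl ((hmemK w).2 ⟨hw', ?_⟩)
      rw [← hC, ConnectedComponent.eq]
      exact Adj.reachable (G := G.induce _) (u := ⟨w, hw'⟩) (v := ⟨v, h⟩) hvw.symm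
  have hdegK : ∀ v ∈ K, 10 ≤ pairCount G.Adj {v} (K ∪ N) := by
    intro v hv
    have h1 := hdeg v hv
    have h2 : G.neighborFinset v = (K ∪ N).filter (G.Adj v) := by
      ext w
      rw [mem_neighborFinset, Finset.mem_filter]
      exact ⟨fun h => ⟨hnbr v hv w h, h⟩, fun h => h.2⟩
    rwa [← card_neighborFinset_eq_degree, h2, ← pairCount_singleton] at h1
  obtain ⟨⟨y, hy⟩, hyC⟩ := C.exists_rep
  have hyK : y ∈ K := (hmemK y).2 ⟨hy, hyC⟩
  have hKpos : 0 < K.card := Finset.card_pos.2 ⟨y, hyK⟩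
  have hNcard : N.card = G.degree u := card_neighborFinset_eq_degree _ _
  have hsum := mul_le_pairCount hdegK
  rw [pairCount_union_right _ _ hKN] at hsum
  have hNN : N.card * 5 ≤ edgeCount G N := mul_le_pairCount fun v hv => by
    rw [hN, card_inter_neighborFinset]
    exact htri u v (by simpa [hN] using hv) hu
  have hKu : pairCount G.Adj {u} (K ∪ N) = N.card := by
    rw [pairCount_singleton]
    congr 1
    ext w
    rw [Finset.mem_filter, Finset.mem_union, hN, mem_neighborFinset]
    exact ⟨fun h => h.2, fun h => ⟨Or.inr h, h⟩⟩
  have huKN : u ∉ K ∪ N := by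
    rw [Finset.mem_union]
    exact not_or.2 ⟨huK, huN⟩
  have hall := edgeCount_erase G (Finset.mem_insert_self u (K ∪ N))
  rw [← pairCount_erase, Finset.erase_insert huKN, hKu, edgeCount_union G hKN] at hall
  have hcardKN : (K ∪ N).card = K.card + N.card := Finset.card_union_of_disjoint hKN
  have hcard : (insert u (K ∪ N)).card = K.card + N.card + 1 := by
    rw [Finset.card_insert_of_notMem huKN, hcardKN]
  have hlarge := pairCount_lt_card G (Finset.mem_union_left N hyK)
  have hy10 := hdegK y hyK
  have hbound := edgeCount_add_le hfree (A := insert u (K ∪ N)) (by omega)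
  change K.card * 10 ≤ edgeCount G K + _ at hsum
  rcases Nat.lt_or_ge K.card 5 with hlt | hge
  · have h1 := edgeCount_le G K
    generalize K.card = c at *
    interval_cases c <;> omega
  · have h1 := edgeCount_add_le hfree hge
    omega
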